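/- arXiv:2006.02401 — 2 statements merged into one kernel-verified Lean document; each statement's English description precedes it below -/
import Mathlib

section
/- There exists a surjective group homomorphism φ from the presented group V̂_τ onto ℤ/2ℤ satisfying φ(x_n) = φ(π_n) = 0 for all n ≥ 0, φ(c_n) = 0 for all n ≥ 1, and φ(y_n) = 1 for all n ≥ 0; consequently its kernel is a normal subgroup of index 2, and in particular V̂_τ is not simple. -/
/-!
STATEMENT 9: There exists a surjective group homomorphism `φ` from the presented group `V̂_τ`
onto ℤ/2ℤ with `φ(x_n) = φ(π_n) = 0` (n ≥ 0), `φ(c_n) = 0` (n ≥ 1) and `φ(y_n) = 1` (n ≥ 0);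
consequently its kernel is a normal subgroup of index 2, and in particular `V̂_τ` is not simple.
(ℤ/2ℤ is taken in multiplicative notation as `Multiplicative (ZMod 2)`.)
-/

noncomputable section

/-- Generators of the presented group `V̂_τ`: `x n`, `y n`, `p n` (the transpositions `π_n`)
for `n ≥ 0` and `c n` for `n ≥ 1` (indexed by positive naturals). -/
inductive VGen : Type
  | x : ℕ → VGen
  | y : ℕ → VGen
  | p : ℕ → VGen
  | c : ℕ+ → VGen

namespace VGen

/-- The free-group generator `x_n`. -/
def X (n : ℕ) : FreeGroup VGen := FreeGroup.of (VGen.x n)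
/-- The free-group generator `y_n`. -/
def Y (n : ℕ) : FreeGroup VGen := FreeGroup.of (VGen.y n)
/-- The free-group generator `π_n`. -/
def P (n : ℕ) : FreeGroup VGen := FreeGroup.of (VGen.p n)
/-- The free-group generator `c_n`, `n ≥ 1`. -/
def C (n : ℕ+) : FreeGroup VGen := FreeGroup.of (VGen.c n)

/-- The defining relators of `V̂_τ` (each relation `u = v` is recorded as `u * v⁻¹`). -/
def VRels : Set (FreeGroup VGen) :=
  -- (1.1)–(1.4): a_j b_i = b_i a_{j+1} for i < j, a, b ∈ {x, y}
  (⋃ (i : ℕ) (j : ℕ) (_ : i < j),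
    ({X j * X i * (X i * X (j + 1))⁻¹,
      X j * Y i * (Y i * X (j + 1))⁻¹,
      Y j * X i * (X i * Y (j + 1))⁻¹,
      Y j * Y i * (Y i * Y (j + 1))⁻¹} : Set (FreeGroup VGen))) ∪
  -- (1.5): y_n² = x_n x_{n+1}
  (⋃ (n : ℕ), ({Y n ^ 2 * (X n * X (n + 1))⁻¹} : Set (FreeGroup VGen))) ∪
  -- (2.1) and (3.1): a_k c_{n+1} = c_n a_{k+1} for 1 ≤ k < n, a ∈ {x, y}
  (⋃ (k : ℕ) (n : ℕ+) (_ : 1 ≤ k) (_ : (k : ℕ) < (n : ℕ)),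
    ({X k * C (n + 1) * (C n * X (k + 1))⁻¹,
      Y k * C (n + 1) * (C n * Y (k + 1))⁻¹} : Set (FreeGroup VGen))) ∪
  -- (2.2), (2.3), (2.4), (3.2), for n ≥ 1
  (⋃ (n : ℕ+),
    ({C n * X 0 * (C (n + 1) ^ 2)⁻¹,
      C n * (X (n : ℕ) * C (n + 1))⁻¹,
      C n ^ ((n : ℕ) + 2),
      C n * Y 0 * ((Y ((n : ℕ) + 1))⁻¹ * C (n + 1) ^ 2)⁻¹} : Set (FreeGroup VGen))) ∪
  -- (4.1), (4.7), (6.1): π_i commutes with x_j, π_j, y_j for j ≥ i + 2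
  (⋃ (i : ℕ) (j : ℕ) (_ : i + 2 ≤ j),
    ({P i * X j * (X j * P i)⁻¹,
      P i * P j * (P j * P i)⁻¹,
      P i * Y j * (Y j * P i)⁻¹} : Set (FreeGroup VGen))) ∪
  -- (4.2), (4.3), (4.5), (4.6), (6.2), (6.3)
  (⋃ (i : ℕ),
    ({P i * X (i + 1) * (X i * P (i + 1) * P i)⁻¹,
      P i * X i * (X (i + 1) * P i * P (i + 1))⁻¹,
      P i ^ 2,
      (P (i + 1) * P i) ^ 3,
      P i * Y (i + 1) * (Y i * P (i + 1) * P i)⁻¹,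
      P i * Y i * (Y (i + 1) * P i * P (i + 1))⁻¹} : Set (FreeGroup VGen))) ∪
  -- (4.4), (6.4): π_i a_j = a_j π_{i+1} for 0 ≤ j < i, a ∈ {x, y}
  (⋃ (i : ℕ) (j : ℕ) (_ : j < i),
    ({P i * X j * (X j * P (i + 1))⁻¹,
      P i * Y j * (Y j * P (i + 1))⁻¹} : Set (FreeGroup VGen))) ∪
  -- (5.1): c_n π_k = π_{k−1} c_n for 1 ≤ k ≤ n − 1
  (⋃ (n : ℕ+) (k : ℕ) (_ : 1 ≤ k) (_ : k ≤ (n : ℕ) - 1),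
    ({C n * P k * (P (k - 1) * C n)⁻¹} : Set (FreeGroup VGen))) ∪
  -- (5.2), (5.3), (5.4), for n ≥ 1
  (⋃ (n : ℕ+),
    ({C n * P 0 * (((List.range (n : ℕ)).map P).prod * C n ^ 2)⁻¹,
      C n ^ 2 * P 0 * (((List.range (n : ℕ)).reverse.map P).prod * C n)⁻¹,
      C n ^ 3 * P 0 * (P ((n : ℕ) - 1) * C n ^ 3)⁻¹} : Set (FreeGroup VGen)))

end VGen

/-- The presented group `V̂_τ`. -/
abbrev VhatTau : Type := PresentedGroup VGen.VRels

/-- The generator `x_n` of `V̂_τ`. -/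
def vxg (n : ℕ) : VhatTau := PresentedGroup.of (VGen.x n)
/-- The generator `y_n` of `V̂_τ`. -/
def vyg (n : ℕ) : VhatTau := PresentedGroup.of (VGen.y n)
/-- The generator `π_n` of `V̂_τ`. -/
def vpg (n : ℕ) : VhatTau := PresentedGroup.of (VGen.p n)
/-- The generator `c_n` of `V̂_τ`, `n ≥ 1`. -/
def vcg (n : ℕ+) : VhatTau := PresentedGroup.of (VGen.c n)

/-- A group with a shift endomorphism `s` and elements `x`, `y`, `p`, `c` whose iterated shifts
satisfy the defining relations of `V̂_τ`. Here `s g` and `l g` play the role of `g` acting below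
the right, respectively left, leaf of the root caret. -/
structure ShiftSystem (G : Type*) [Group G] where
  /-- The action below the right leaf. -/
  s : G →* G
  /-- The action below the left leaf. -/
  l : G →* G
  /-- The image of `x_0`. -/
  x : G
  /-- The image of `y_0`. -/
  y : G
  /-- The image of `π_0`. -/
  p : G
  /-- The swap of the two leaves of the root caret. -/
  c : G
  s_mul_x : ∀ g, s g * x = x * s (s g)
  s_mul_y : ∀ g, s g * y = y * s (s g)
  y_mul_y : y * y = x * s x
  p_comm : ∀ g, p * s (s g) = s (s g) * p
  p_mul_sx : p * s x = x * s p * p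
  p_mul_x : p * x = s x * p * s p
  p_mul_sy : p * s y = y * s p * p
  p_mul_y : p * y = s y * p * s p
  p_mul_p : p * p = 1
  sp_mul_p_pow : (s p * p) ^ 3 = 1
  c_mul_s : ∀ g, c * s g = l g * c
  c_mul_c : c * c = 1
  l_s_mul_x : ∀ g, l (s g) * x = x * s (l g)
  l_x_mul : l x * (x * s x) = x * x
  l_y_mul : l y * (x * s x) = x * y
  l_p_mul : l p * (x * s x) = x * s x * p
  l_y_mul_y : l y * y = x
  c_mul_x_pow : (c * x) ^ 3 = 1
  c_mul_p : c * p = x * p * c * x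

namespace ShiftSystem

variable {G : Type*} [Group G] (S : ShiftSystem G)

/-- The `n`-fold shift of an element. -/
def shift (n : ℕ) (g : G) : G := S.s^[n] g

@[simp] lemma shift_zero (g : G) : S.shift 0 g = g := rfl

lemma shift_succ (n : ℕ) (g : G) : S.shift (n + 1) g = S.s (S.shift n g) :=
  Function.iterate_succ_apply' _ _ _

lemma shift_add (m n : ℕ) (g : G) : S.shift (m + n) g = S.shift m (S.shift n g) :=
  Function.iterate_add_apply _ _ _ _

lemma shift_mul (n : ℕ) (g h : G) : S.shift n (g * h) = S.shift n g * S.shift n h := by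
  induction n with
  | zero => rfl
  | succ n ih => simp only [shift_succ, ih, map_mul]

lemma shift_one (n : ℕ) : S.shift n (1 : G) = 1 := by
  induction n with
  | zero => rfl
  | succ n ih => simp only [shift_succ, ih, map_one]

lemma shift_pow (n k : ℕ) (g : G) : S.shift n (g ^ k) = S.shift n g ^ k := by
  induction k with
  | zero => simp [shift_one]
  | succ k ih => simp only [pow_succ, shift_mul, ih]

lemma shift_shift_succ (n k : ℕ) (g : G) :
    S.shift n (S.shift k (S.s g)) = S.shift (n + k + 1) g := by
  rw [show S.s g = S.shift 1 g from rfl, ← shift_add, ← shift_add]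

lemma shift_s (n : ℕ) (g : G) : S.shift n (S.s g) = S.shift (n + 1) g :=
  S.shift_shift_succ n 0 g

lemma shift_mul_shift_of_lt {i j : ℕ} (hij : i < j) {b : G}
    (hb : ∀ g, S.s g * b = b * S.s (S.s g)) (g : G) :
    S.shift j g * S.shift i b = S.shift i b * S.shift (j + 1) g := by
  obtain ⟨k, rfl⟩ := Nat.exists_eq_add_of_lt hij
  have := congrArg (S.shift i) (hb (S.shift k g))
  simpa only [shift_mul, ← shift_succ, ← shift_add, add_assoc] using this

lemma shift_p_comm {i j : ℕ} (hij : i + 2 ≤ j) (g : G) :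
    S.shift i S.p * S.shift j g = S.shift j g * S.shift i S.p := by
  obtain ⟨k, rfl⟩ := Nat.exists_eq_add_of_le hij
  have := congrArg (S.shift i) (S.p_comm (S.shift k g))
  simp only [shift_mul, ← shift_succ, ← shift_add] at this
  rwa [show i + (k + 1 + 1) = i + 2 + k by omega] at this

/-- The product `x_0 x_1 ⋯ x_{n-1}`. -/
def spine : ℕ → G
  | 0 => 1
  | n + 1 => spine n * S.shift n S.x

lemma spine_succ (n : ℕ) : S.spine (n + 1) = S.spine n * S.shift n S.x := rfl

lemma spine_succ' (n : ℕ) : S.spine (n + 1) = S.x * S.s (S.spine n) := by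
  induction n with
  | zero => simp [spine]
  | succ n ih =>
    rw [spine_succ, ih, mul_assoc, shift_succ, ← map_mul, ← spine_succ, ih]

/-- The image of `c_n`: the rotation of the `n + 2` leaves of the right spine. -/
def rot (n : ℕ) : G := (S.spine n)⁻¹ * S.c

lemma rot_eq (n : ℕ) : S.rot n = S.shift n S.x * S.rot (n + 1) := by
  simp [rot, spine_succ, mul_assoc]

lemma rot_succ (n : ℕ) : S.rot (n + 1) = (S.shift n S.x)⁻¹ * S.rot n := by
  rw [rot_eq S n, inv_mul_cancel_left]

lemma l_shift_mul_spine {b : G} (hb : ∀ g, S.s g * b = b * S.s (S.s g))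
    (hl : S.l b * (S.x * S.s S.x) = S.x * b) {k n : ℕ} (hkn : k < n) :
    S.l (S.shift k b) * S.spine (n + 1) = S.spine n * S.shift k b := by
  induction k generalizing n with
  | zero =>
    obtain ⟨m, rfl⟩ := Nat.exists_eq_add_of_lt hkn
    simp only [shift_zero, zero_add]
    rw [spine_succ' S (m + 1), spine_succ' S m, map_mul, ← mul_assoc S.x, ← mul_assoc, hl,
      mul_assoc, mul_assoc, hb]
  | succ k ih =>
    obtain ⟨m, rfl⟩ : ∃ m, n = m + 1 := ⟨n - 1, by omega⟩
    rw [shift_succ, spine_succ' S (m + 1), ← mul_assoc, l_s_mul_x, mul_assoc, ← map_mul,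
      ih (by omega), map_mul, spine_succ' S m, mul_assoc]

lemma l_shift_p_mul_spine {k n : ℕ} (hkn : k + 2 ≤ n) :
    S.l (S.shift k S.p) * S.spine n = S.spine n * S.shift k S.p := by
  induction k generalizing n with
  | zero =>
    obtain ⟨m, rfl⟩ : ∃ m, n = m + 1 + 1 := ⟨n - 2, by omega⟩
    simp only [shift_zero]
    rw [spine_succ' S (m + 1), spine_succ' S m, map_mul, ← mul_assoc S.x, ← mul_assoc, l_p_mul,
      mul_assoc, mul_assoc (S.x * S.s S.x), p_comm]
  | succ k ih =>
    obtain ⟨m, rfl⟩ : ∃ m, n = m + 1 := ⟨n - 1, by omega⟩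
    rw [shift_succ, spine_succ', ← mul_assoc, l_s_mul_x, mul_assoc, ← map_mul,
      ih (by omega), map_mul, mul_assoc]

lemma shift_mul_rot {b : G} (hb : ∀ g, S.s g * b = b * S.s (S.s g))
    (hl : S.l b * (S.x * S.s S.x) = S.x * b) {k n : ℕ} (hkn : k < n) :
    S.shift k b * S.rot (n + 1) = S.rot n * S.shift (k + 1) b := by
  rw [rot, rot, mul_assoc, shift_succ, c_mul_s, eq_inv_mul_iff_mul_eq, ← mul_assoc, ← mul_assoc,
    ← S.l_shift_mul_spine hb hl hkn, mul_inv_cancel_right]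

lemma rot_mul_shift_p {k n : ℕ} (hkn : k + 2 ≤ n) :
    S.rot n * S.shift (k + 1) S.p = S.shift k S.p * S.rot n := by
  rw [rot, mul_assoc, shift_succ, c_mul_s, inv_mul_eq_iff_eq_mul, ← mul_assoc, ← mul_assoc,
    ← S.l_shift_p_mul_spine hkn, mul_inv_cancel_right]

lemma shift_x_mul_rot {k n : ℕ} (hkn : k < n) :
    S.shift k S.x * S.rot (n + 1) = S.rot n * S.shift (k + 1) S.x :=
  S.shift_mul_rot S.s_mul_x S.l_x_mul hkn

lemma rot_mul_x (n : ℕ) : S.rot n * S.x = S.rot (n + 1) ^ 2 := by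
  induction n with
  | zero =>
    have hc : S.c⁻¹ = S.c := inv_eq_of_mul_eq_one_left S.c_mul_c
    have h : S.rot 1 = (S.c * S.x)⁻¹ := by simp [rot, spine, hc]
    rw [h, inv_pow, eq_inv_iff_mul_eq_one, ← S.c_mul_x_pow, pow_succ' _ 2]
    simp [rot, spine]
  | succ n ih =>
    have h := S.shift_x_mul_rot (Nat.lt_succ_self n)
    calc S.rot (n + 1) * S.x = (S.shift n S.x)⁻¹ * S.rot (n + 1) ^ 2 := by
            rw [← ih, rot_succ, mul_assoc]
      _ = S.rot (n + 2) * (S.shift (n + 1) S.x)⁻¹ * S.rot (n + 1) := by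
            rw [sq, ← mul_assoc]
            congr 1
            rw [inv_mul_eq_iff_eq_mul, ← mul_assoc, h, mul_inv_cancel_right]
      _ = S.rot (n + 2) ^ 2 := by rw [mul_assoc, ← rot_succ, sq]

lemma rot_pow_eq {m n : ℕ} (h : m ≤ n) :
    S.rot n ^ (m + 1) = S.shift (n - m) S.x * S.rot (n + 1) ^ (m + 1) := by
  induction m with
  | zero => simpa using S.rot_eq n
  | succ m ih =>
    rw [pow_succ', ih (by omega), ← mul_assoc, show n - m = n - (m + 1) + 1 by omega,
      ← S.shift_x_mul_rot (by omega), mul_assoc, ← pow_succ']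

lemma rot_pow (n : ℕ) : S.rot n ^ (n + 2) = 1 := by
  induction n with
  | zero => simp [rot, spine, sq, c_mul_c]
  | succ n ih =>
    rw [← ih, pow_succ' (S.rot n), S.rot_pow_eq le_rfl, Nat.sub_self, shift_zero, ← mul_assoc,
      rot_mul_x, ← pow_add]
    congr 1
    omega

lemma shift_mul_spine (n : ℕ) (g : G) :
    S.s g * S.spine n = S.spine n * S.shift (n + 1) g := by
  induction n with
  | zero => simp [spine, shift_succ]
  | succ n ih =>
    rw [spine_succ, ← mul_assoc, ih, mul_assoc, mul_assoc,
      S.shift_mul_shift_of_lt (Nat.lt_succ_self n) S.s_mul_x]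

lemma rot_mul_y (n : ℕ) :
    S.rot n * S.y = (S.shift (n + 1) S.y)⁻¹ * S.rot (n + 1) ^ 2 := by
  have hc : S.c * S.l S.y = S.s S.y * S.c := by
    have h := congrArg (fun g => S.c * g * S.c) (S.c_mul_s S.y)
    simp only [mul_assoc, c_mul_c, mul_one] at h
    rw [← h, ← mul_assoc, c_mul_c, one_mul]
  calc S.rot n * S.y
      = (S.shift (n + 1) S.y)⁻¹ * (S.spine n)⁻¹ * (S.s S.y * S.c) * S.y := by
          rw [← mul_inv_rev, ← S.shift_mul_spine n S.y, rot]
          group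
    _ = (S.shift (n + 1) S.y)⁻¹ * S.rot (n + 1) ^ 2 := by
          rw [← hc, ← rot_mul_x, rot, ← S.l_y_mul_y]
          simp only [mul_assoc]

/-- The product `π_0 π_1 ⋯ π_{n-1}`. -/
def piProd (n : ℕ) : G := ((List.range n).map fun i => S.shift i S.p).prod

lemma piProd_succ (n : ℕ) : S.piProd (n + 1) = S.piProd n * S.shift n S.p := by
  simp [piProd, List.range_succ]

lemma shift_p_mul_self (n : ℕ) : S.shift n S.p * S.shift n S.p = 1 := by
  rw [← shift_mul, p_mul_p, shift_one]

lemma piProd_inv (n : ℕ) :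
    ((List.range n).reverse.map fun i => S.shift i S.p).prod = (S.piProd n)⁻¹ := by
  induction n with
  | zero => simp [piProd]
  | succ n ih =>
    rw [piProd_succ, mul_inv_rev, ← ih, inv_eq_of_mul_eq_one_left (S.shift_p_mul_self n)]
    simp [List.range_succ]

lemma piProd_comm {n j : ℕ} (h : n + 1 ≤ j) (g : G) :
    S.piProd n * S.shift j g = S.shift j g * S.piProd n := by
  induction n with
  | zero => simp [piProd]
  | succ n ih =>
    rw [piProd_succ, mul_assoc, S.shift_p_comm (by omega), ← mul_assoc, ih (by omega), mul_assoc]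

lemma piProd_mul_shift_x (n : ℕ) :
    S.piProd (n + 1) * S.shift n S.x = S.shift (n + 1) S.x * S.piProd (n + 2) := by
  have h := congrArg (S.shift n) S.p_mul_x
  simp only [shift_mul, shift_s] at h
  rw [piProd_succ, mul_assoc, h, piProd_succ S (n + 1), piProd_succ, ← mul_assoc, ← mul_assoc,
    S.piProd_comm le_rfl]
  simp only [mul_assoc]

lemma rot_mul_p (n : ℕ) : S.rot (n + 1) * S.p = S.piProd (n + 1) * S.rot (n + 1) ^ 2 := by
  induction n with
  | zero =>
    have h : S.piProd 1 = S.p := by simp [piProd]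
    rw [← rot_mul_x, zero_add, h]
    simp only [rot, spine, shift_zero, one_mul, inv_one]
    rw [mul_assoc, c_mul_p]
    group
  | succ n ih =>
    have h : S.rot (n + 1) ^ 2 = S.shift n S.x * S.rot (n + 2) ^ 2 := by
      rw [sq]
      nth_rw 2 [rot_eq]
      rw [← mul_assoc, ← S.shift_x_mul_rot (Nat.lt_succ_self n), mul_assoc, sq]
    rw [rot_succ, mul_assoc, ih, inv_mul_eq_iff_eq_mul, h, ← mul_assoc, piProd_mul_shift_x,
      mul_assoc, ← rot_succ]

lemma rot_sq_mul_p (n : ℕ) :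
    S.rot (n + 1) ^ 2 * S.p = (S.piProd (n + 1))⁻¹ * S.rot (n + 1) := by
  rw [eq_inv_mul_iff_mul_eq, ← mul_assoc, ← rot_mul_p, mul_assoc, p_mul_p, mul_one]

lemma rot_mul_shift_piProd {m n : ℕ} (h : m + 1 ≤ n) :
    S.rot n * (S.p * S.piProd (m + 1)) = S.piProd m * S.rot n := by
  induction m with
  | zero => simp [piProd, p_mul_p]
  | succ m ih =>
    rw [piProd_succ, ← mul_assoc S.p, ← mul_assoc, ih (by omega), mul_assoc,
      S.rot_mul_shift_p (by omega), ← mul_assoc, ← piProd_succ]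

lemma rot_cube_mul_p (n : ℕ) :
    S.rot (n + 1) ^ 3 * S.p = S.shift n S.p * S.rot (n + 1) ^ 3 := by
  have h := S.rot_mul_shift_piProd (le_refl (n + 1))
  have h' : S.rot (n + 1) * (S.piProd (n + 1))⁻¹
      = (S.piProd n)⁻¹ * (S.rot (n + 1) * S.p) := by
    rw [eq_inv_mul_iff_mul_eq, ← mul_assoc, ← h]
    simp only [mul_assoc, mul_inv_cancel, mul_one]
  rw [pow_succ', mul_assoc, rot_sq_mul_p, ← mul_assoc, h', rot_mul_p, piProd_succ]
  simp only [mul_assoc, inv_mul_cancel_left, pow_succ, pow_zero, one_mul]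

end ShiftSystem

/-- A set with two decompositions `a`, `b` into two copies of itself, such that splitting the left
half of `a` by `a` gives the same three pieces as splitting the right half of `b` by `b`. -/
structure GoldenSplitting (Ω : Type*) where
  /-- The splitting by a caret of type `y`. -/
  a : Ω ⊕ Ω ≃ Ω
  /-- The splitting by a caret of type `x`. -/
  b : Ω ⊕ Ω ≃ Ω
  a_inl_a_inl : ∀ t, a (.inl (a (.inl t))) = b (.inl t)
  a_inl_a_inr : ∀ t, a (.inl (a (.inr t))) = b (.inr (b (.inl t)))
  a_inr : ∀ t, a (.inr t) = b (.inr (b (.inr t)))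

namespace GoldenSplitting

variable {Ω : Type*} (W : GoldenSplitting Ω)

/-- The decomposition into the three leaves of the right spine. -/
def tri : Ω ⊕ (Ω ⊕ Ω) ≃ Ω := (Equiv.sumCongr (Equiv.refl Ω) W.b).trans W.b

/-- The permutation carrying the right spine with three leaves to the tree whose root is split by
`b` and whose left leaf is split by `e`. -/
def graft (e : Ω ⊕ Ω ≃ Ω) : Equiv.Perm Ω :=
  W.tri.symm.trans <| (Equiv.sumAssoc Ω Ω Ω).symm.trans <|
    (Equiv.sumCongr e (Equiv.refl Ω)).trans W.b

/-- The swap of the first two leaves of the right spine with three leaves. -/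
def swapLeaves : Equiv.Perm Ω :=
  W.tri.symm.trans <| (Equiv.sumAssoc Ω Ω Ω).symm.trans <|
    (Equiv.sumCongr (Equiv.sumComm Ω Ω) (Equiv.refl Ω)).trans <|
    (Equiv.sumAssoc Ω Ω Ω).trans W.tri

/-- The swap of the two halves of the decomposition `b`. -/
def swapHalves : Equiv.Perm Ω := W.b.permCongr (Equiv.sumComm Ω Ω)

/-- The homomorphism letting a pair of permutations act on the two halves of `b`. -/
def plus : Equiv.Perm Ω × Equiv.Perm Ω →* Equiv.Perm Ω :=
  W.b.permCongrHom.toMonoidHom.comp (Equiv.Perm.sumCongrHom Ω Ω)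

@[simp] lemma plus_inl (f : Equiv.Perm Ω × Equiv.Perm Ω) (t : Ω) :
    W.plus f (W.b (.inl t)) = W.b (.inl (f.1 t)) := by
  simp [plus, Equiv.permCongrHom]

@[simp] lemma plus_inr (f : Equiv.Perm Ω × Equiv.Perm Ω) (t : Ω) :
    W.plus f (W.b (.inr t)) = W.b (.inr (f.2 t)) := by
  simp [plus, Equiv.permCongrHom]

@[simp] lemma swapHalves_inl (t : Ω) : W.swapHalves (W.b (.inl t)) = W.b (.inr t) := by
  simp [swapHalves]

@[simp] lemma swapHalves_inr (t : Ω) : W.swapHalves (W.b (.inr t)) = W.b (.inl t) := by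
  simp [swapHalves]

@[simp] lemma graft_inl (e : Ω ⊕ Ω ≃ Ω) (t : Ω) :
    W.graft e (W.b (.inl t)) = W.b (.inl (e (.inl t))) := by
  simp [graft, tri]

@[simp] lemma graft_inr_inl (e : Ω ⊕ Ω ≃ Ω) (t : Ω) :
    W.graft e (W.b (.inr (W.b (.inl t)))) = W.b (.inl (e (.inr t))) := by
  simp [graft, tri]

@[simp] lemma graft_inr_inr (e : Ω ⊕ Ω ≃ Ω) (t : Ω) :
    W.graft e (W.b (.inr (W.b (.inr t)))) = W.b (.inr t) := by
  simp [graft, tri]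

@[simp] lemma swapLeaves_inl (t : Ω) :
    W.swapLeaves (W.b (.inl t)) = W.b (.inr (W.b (.inl t))) := by
  simp [swapLeaves, tri]

@[simp] lemma swapLeaves_inr_inl (t : Ω) :
    W.swapLeaves (W.b (.inr (W.b (.inl t)))) = W.b (.inl t) := by
  simp [swapLeaves, tri]

@[simp] lemma swapLeaves_inr_inr (t : Ω) :
    W.swapLeaves (W.b (.inr (W.b (.inr t)))) = W.b (.inr (W.b (.inr t))) := by
  simp [swapLeaves, tri]

lemma eq_of_halves {f g : Equiv.Perm Ω} (h₁ : ∀ t, f (W.b (.inl t)) = g (W.b (.inl t)))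
    (h₂ : ∀ t, f (W.b (.inr t)) = g (W.b (.inr t))) : f = g := by
  ext t
  obtain ⟨t | t, rfl⟩ := W.b.surjective t
  exacts [h₁ t, h₂ t]

lemma eq_of_leaves {f g : Equiv.Perm Ω} (h₁ : ∀ t, f (W.b (.inl t)) = g (W.b (.inl t)))
    (h₂ : ∀ t, f (W.b (.inr (W.b (.inl t)))) = g (W.b (.inr (W.b (.inl t)))))
    (h₃ : ∀ t, f (W.b (.inr (W.b (.inr t)))) = g (W.b (.inr (W.b (.inr t))))) : f = g := by
  refine W.eq_of_halves h₁ fun t => ?_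
  obtain ⟨t | t, rfl⟩ := W.b.surjective t
  exacts [h₂ t, h₃ t]

lemma eq_of_four_leaves {f g : Equiv.Perm Ω} (h₁ : ∀ t, f (W.b (.inl t)) = g (W.b (.inl t)))
    (h₂ : ∀ t, f (W.b (.inr (W.b (.inl t)))) = g (W.b (.inr (W.b (.inl t)))))
    (h₃ : ∀ t, f (W.b (.inr (W.b (.inr (W.b (.inl t)))))) =
      g (W.b (.inr (W.b (.inr (W.b (.inl t)))))))
    (h₄ : ∀ t, f (W.b (.inr (W.b (.inr (W.b (.inr t)))))) =
      g (W.b (.inr (W.b (.inr (W.b (.inr t))))))) : f = g := by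
  refine W.eq_of_leaves h₁ h₂ fun t => ?_
  obtain ⟨t | t, rfl⟩ := W.b.surjective t
  exacts [h₃ t, h₄ t]

/-- The shift system of permutations attached to a golden splitting. -/
def shiftSystem : ShiftSystem (Equiv.Perm Ω) where
  s := W.plus.comp (MonoidHom.inr _ _)
  l := W.plus.comp (MonoidHom.inl _ _)
  x := W.graft W.b
  y := W.graft W.a
  p := W.swapLeaves
  c := W.swapHalves
  s_mul_x g := by apply W.eq_of_leaves <;> simp
  s_mul_y g := by apply W.eq_of_leaves <;> simp
  y_mul_y := by
    refine W.eq_of_four_leaves (fun t => ?_) (fun t => ?_) (fun t => ?_) fun t => ?_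
    · simp [W.a_inl_a_inl]
    · simp [W.a_inl_a_inr]
    all_goals simp [W.a_inr]
  p_comm g := by apply W.eq_of_leaves <;> simp
  p_mul_sx := by apply W.eq_of_four_leaves <;> simp
  p_mul_x := by apply W.eq_of_four_leaves <;> simp
  p_mul_sy := by apply W.eq_of_four_leaves <;> simp
  p_mul_y := by apply W.eq_of_four_leaves <;> simp
  p_mul_p := by apply W.eq_of_leaves <;> simp
  sp_mul_p_pow := by apply W.eq_of_four_leaves <;> simp [pow_succ]
  c_mul_s g := by apply W.eq_of_halves <;> simp
  c_mul_c := by apply W.eq_of_halves <;> simp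
  l_s_mul_x g := by apply W.eq_of_leaves <;> simp
  l_x_mul := by apply W.eq_of_four_leaves <;> simp
  l_y_mul := by apply W.eq_of_four_leaves <;> simp
  l_p_mul := by apply W.eq_of_four_leaves <;> simp
  l_y_mul_y := by
    refine W.eq_of_leaves (fun t => ?_) ?_ ?_
    · obtain ⟨t | t, rfl⟩ := W.a.surjective t <;> simp [W.a_inl_a_inl, W.a_inl_a_inr]
    all_goals simp [W.a_inr]
  c_mul_x_pow := by apply W.eq_of_leaves <;> simp [pow_succ]
  c_mul_p := by apply W.eq_of_leaves <;> simp

lemma swapLeaves_ne_one [Nonempty Ω] : W.swapLeaves ≠ 1 := by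
  intro h
  obtain ⟨t⟩ := ‹Nonempty Ω›
  have := congrArg (fun f => f (W.b (.inl t))) h
  simp at this

end GoldenSplitting

/-- The affine map of the half-open unit interval onto `[0, ρ)` or `[ρ, 1)`. -/
def affineHalves (ρ : ℝ) (h₀ : 0 < ρ) (h₁ : ρ < 1) :
    Set.Ico (0 : ℝ) 1 ⊕ Set.Ico (0 : ℝ) 1 → Set.Ico (0 : ℝ) 1
  | .inl t => ⟨ρ * t, mul_nonneg h₀.le t.2.1, by nlinarith [t.2.1, t.2.2]⟩
  | .inr t => ⟨ρ + (1 - ρ) * t, by nlinarith [t.2.1, t.2.2], by nlinarith [t.2.1, t.2.2]⟩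

lemma affineHalves_bijective (ρ : ℝ) (h₀ : 0 < ρ) (h₁ : ρ < 1) :
    Function.Bijective (affineHalves ρ h₀ h₁) := by
  have h₁' : 0 < 1 - ρ := sub_pos.2 h₁
  constructor
  · rintro (⟨t, ht⟩ | ⟨t, ht⟩) (⟨u, hu⟩ | ⟨u, hu⟩) h <;>
      replace h := congrArg Subtype.val h <;> simp only [affineHalves] at h
    · simpa [h₀.ne'] using h
    · nlinarith [ht.2, hu.1, mul_nonneg h₁'.le hu.1]
    · nlinarith [hu.2, ht.1, mul_nonneg h₁'.le ht.1]
    · simpa [h₁'.ne'] using h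
  · rintro ⟨t, ht⟩
    rcases lt_or_ge t ρ with h | h
    · refine ⟨.inl ⟨t / ρ, div_nonneg ht.1 h₀.le, (div_lt_one h₀).2 h⟩, ?_⟩
      simp only [affineHalves, mul_div_cancel₀ t h₀.ne']
    · refine ⟨.inr ⟨(t - ρ) / (1 - ρ), div_nonneg (sub_nonneg.2 h) h₁'.le,
        (div_lt_one h₁').2 (by linarith [ht.2])⟩, ?_⟩
      simp only [affineHalves, mul_div_cancel₀ _ h₁'.ne', add_sub_cancel]

/-- The golden splitting of the half-open unit interval given by `τ` with `τ ^ 2 + τ = 1`. -/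
def GoldenSplitting.unitInterval (τ : ℝ) (h₀ : 0 < τ) (h₁ : τ < 1) (h : τ ^ 2 + τ = 1) :
    GoldenSplitting (Set.Ico (0 : ℝ) 1) where
  a := Equiv.ofBijective _ (affineHalves_bijective τ h₀ h₁)
  b := Equiv.ofBijective _ (affineHalves_bijective (1 - τ) (by linarith) (by linarith))
  a_inl_a_inl t := by
    ext
    simp only [Equiv.ofBijective_apply, affineHalves]
    linear_combination (t : ℝ) * h
  a_inl_a_inr t := by
    ext
    simp only [Equiv.ofBijective_apply, affineHalves]
    linear_combination h
  a_inr t := by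
    ext
    simp only [Equiv.ofBijective_apply, affineHalves]
    linear_combination (1 - t : ℝ) * h

lemma exists_goldenSplitting : Nonempty (GoldenSplitting (Set.Ico (0 : ℝ) 1)) := by
  have h5 : √(5 : ℝ) ^ 2 = 5 := Real.sq_sqrt (by norm_num)
  have h0 : 0 ≤ √(5 : ℝ) := Real.sqrt_nonneg 5
  exact ⟨GoldenSplitting.unitInterval ((√5 - 1) / 2) (by nlinarith) (by nlinarith)
    (by linear_combination h5 / 4)⟩

/-- The images of the generators of `V̂_τ` in a shift system. -/
def ShiftSystem.gen {G : Type*} [Group G] (S : ShiftSystem G) : VGen → G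
  | .x n => S.shift n S.x
  | .y n => S.shift n S.y
  | .p n => S.shift n S.p
  | .c n => S.rot n

open VGen in
lemma ShiftSystem.lift_gen_eq_one {G : Type*} [Group G] (S : ShiftSystem G) :
    ∀ r ∈ VRels, FreeGroup.lift S.gen r = 1 := by
  have hX (n : ℕ) : FreeGroup.lift S.gen (X n) = S.shift n S.x := FreeGroup.lift_apply_of
  have hY (n : ℕ) : FreeGroup.lift S.gen (Y n) = S.shift n S.y := FreeGroup.lift_apply_of
  have hP (n : ℕ) : FreeGroup.lift S.gen (P n) = S.shift n S.p := FreeGroup.lift_apply_of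
  have hC (n : ℕ+) : FreeGroup.lift S.gen (C n) = S.rot n := FreeGroup.lift_apply_of
  have hPP : (FreeGroup.lift S.gen ∘ P) = fun i => S.shift i S.p := funext hP
  intro r hr
  simp only [VRels, Set.mem_union, Set.mem_iUnion, Set.mem_insert_iff, Set.mem_singleton_iff,
    exists_prop] at hr
  rcases hr with (((((((⟨i, j, hij, h⟩ | ⟨n, rfl⟩) | ⟨k, n, hk, hkn, h⟩) | ⟨n, h⟩) |
    ⟨i, j, hij, h⟩) | ⟨i, h⟩) | ⟨i, j, hij, h⟩) | ⟨n, k, hk, hkn, rfl⟩) | ⟨n, h⟩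
  · rcases h with rfl | rfl | rfl | rfl <;>
      simp only [map_mul, map_inv, hX, hY, mul_inv_eq_one]
    exacts [S.shift_mul_shift_of_lt hij S.s_mul_x _, S.shift_mul_shift_of_lt hij S.s_mul_y _,
      S.shift_mul_shift_of_lt hij S.s_mul_x _, S.shift_mul_shift_of_lt hij S.s_mul_y _]
  · simp only [map_mul, map_inv, map_pow, hX, hY, mul_inv_eq_one]
    rw [← shift_pow, sq, S.y_mul_y, shift_mul, shift_s]
  · rcases h with rfl | rfl <;>
      simp only [map_mul, map_inv, hX, hY, hC, mul_inv_eq_one, PNat.add_coe, PNat.one_coe]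
    exacts [S.shift_x_mul_rot hkn, S.shift_mul_rot S.s_mul_y S.l_y_mul hkn]
  · rcases h with rfl | rfl | rfl | rfl <;>
      simp only [map_mul, map_inv, map_pow, hX, hY, hC, mul_inv_eq_one, PNat.add_coe,
        PNat.one_coe, shift_zero]
    exacts [S.rot_mul_x n, S.rot_eq n, S.rot_pow n, S.rot_mul_y n]
  · rcases h with rfl | rfl | rfl <;>
      simp only [map_mul, map_inv, hX, hY, hP, mul_inv_eq_one] <;>
      exact S.shift_p_comm hij _
  · rcases h with rfl | rfl | rfl | rfl | rfl | rfl <;>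
      simp only [map_mul, map_inv, map_pow, hX, hY, hP, mul_inv_eq_one, ← shift_s, ← shift_mul,
        ← shift_pow]
    · rw [S.p_mul_sx]
    · rw [S.p_mul_x]
    · rw [sq, S.p_mul_p, shift_one]
    · rw [S.sp_mul_p_pow, shift_one]
    · rw [S.p_mul_sy]
    · rw [S.p_mul_y]
  · rcases h with rfl | rfl <;> simp only [map_mul, map_inv, hX, hY, hP, mul_inv_eq_one]
    exacts [S.shift_mul_shift_of_lt hij S.s_mul_x _, S.shift_mul_shift_of_lt hij S.s_mul_y _]
  · obtain ⟨k, rfl⟩ : ∃ m, k = m + 1 := ⟨k - 1, by omega⟩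
    simp only [map_mul, map_inv, hP, hC, mul_inv_eq_one, Nat.add_sub_cancel]
    exact S.rot_mul_shift_p (by omega)
  · obtain ⟨m, hm⟩ : ∃ m, (n : ℕ) = m + 1 := ⟨n - 1, by have := n.pos; omega⟩
    rcases h with rfl | rfl | rfl <;>
      simp only [map_mul, map_inv, map_pow, map_list_prod, List.map_map, hPP, hP, hC,
        mul_inv_eq_one, hm, shift_zero, Nat.add_sub_cancel, piProd_inv]
    exacts [S.rot_mul_p m, S.rot_sq_mul_p m, S.rot_cube_mul_p m]

lemma vpg_zero_ne_one : vpg 0 ≠ 1 := by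
  obtain ⟨W⟩ := exists_goldenSplitting
  have : Nonempty (Set.Ico (0 : ℝ) 1) := ⟨⟨0, le_rfl, one_pos⟩⟩
  intro h
  have h' := congrArg (PresentedGroup.toGroup W.shiftSystem.lift_gen_eq_one) h
  rw [vpg, PresentedGroup.toGroup.of, map_one] at h'
  exact W.swapLeaves_ne_one h'

/-- The parity of a generator: `y_n` is odd, all other generators are even. -/
def VGen.parity : VGen → Multiplicative (ZMod 2)
  | .y _ => Multiplicative.ofAdd 1
  | _ => 1

open VGen in
lemma VGen.lift_parity_eq_one : ∀ r ∈ VRels, FreeGroup.lift parity r = 1 := by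
  have hX (n : ℕ) : FreeGroup.lift parity (X n) = 1 := FreeGroup.lift_apply_of
  have hY (n : ℕ) : FreeGroup.lift parity (Y n) = Multiplicative.ofAdd 1 :=
    FreeGroup.lift_apply_of
  have hP (n : ℕ) : FreeGroup.lift parity (P n) = 1 := FreeGroup.lift_apply_of
  have hC (n : ℕ+) : FreeGroup.lift parity (C n) = 1 := FreeGroup.lift_apply_of
  have hPP : (FreeGroup.lift parity ∘ P) = fun _ => 1 := funext hP
  have hsq : (Multiplicative.ofAdd 1 : Multiplicative (ZMod 2)) * Multiplicative.ofAdd 1 = 1 := by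
    decide
  have hinv : (Multiplicative.ofAdd 1 : Multiplicative (ZMod 2))⁻¹ = Multiplicative.ofAdd 1 := by
    decide
  intro r hr
  simp only [VRels, Set.mem_union, Set.mem_iUnion, Set.mem_insert_iff, Set.mem_singleton_iff,
    exists_prop] at hr
  rcases hr with (((((((⟨i, j, hij, h⟩ | ⟨n, h⟩) | ⟨k, n, hk, hkn, h⟩) | ⟨n, h⟩) |
    ⟨i, j, hij, h⟩) | ⟨i, h⟩) | ⟨i, j, hij, h⟩) | ⟨n, k, hk, hkn, h⟩) | ⟨n, h⟩
  all_goals try casesm* _ ∨ _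
  all_goals
    subst r
    simp [hX, hY, hP, hC, hPP, sq, hsq, hinv, map_list_prod, List.map_map]

/-- The parity-of-`y` homomorphism `V̂_τ → ℤ/2ℤ` exists, is surjective, its kernel is a
normal subgroup of index 2, and in particular `V̂_τ` is not simple. -/
theorem VhatTau_parity_hom :
    (∃ φ : VhatTau →* Multiplicative (ZMod 2),
      Function.Surjective φ ∧
      (∀ n : ℕ, φ (vxg n) = Multiplicative.ofAdd (0 : ZMod 2)) ∧
      (∀ n : ℕ, φ (vpg n) = Multiplicative.ofAdd (0 : ZMod 2)) ∧
      (∀ n : ℕ+, φ (vcg n) = Multiplicative.ofAdd (0 : ZMod 2)) ∧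
      (∀ n : ℕ, φ (vyg n) = Multiplicative.ofAdd (1 : ZMod 2)) ∧
      (MonoidHom.ker φ).Normal ∧ (MonoidHom.ker φ).index = 2) ∧
    ¬ IsSimpleGroup VhatTau := by
  let φ : VhatTau →* Multiplicative (ZMod 2) := PresentedGroup.toGroup VGen.lift_parity_eq_one
  have hφ (g : VGen) : φ (PresentedGroup.of g) = g.parity := PresentedGroup.toGroup.of _
  have hsurj : Function.Surjective φ := fun z => by
    obtain rfl | rfl : z = 1 ∨ z = Multiplicative.ofAdd 1 := by revert z; decide
    exacts [⟨1, map_one φ⟩, ⟨vyg 0, hφ _⟩]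
  refine ⟨⟨φ, hsurj, fun n => hφ _, fun n => hφ _, fun n => hφ _, fun n => hφ _,
    inferInstance, ?_⟩, fun hs => ?_⟩
  · rw [Subgroup.index_ker, MonoidHom.range_eq_top.2 hsurj, Subgroup.card_top,
      Nat.card_eq_fintype_card]
    rfl
  · rcases hs.eq_bot_or_eq_top_of_normal φ.ker inferInstance with h | h
    · exact vpg_zero_ne_one ((Subgroup.mem_bot).1 (h ▸ (hφ _ : vpg 0 ∈ φ.ker)))
    · have hy : vyg 0 ∈ φ.ker := h ▸ Subgroup.mem_top _
      exact absurd ((hφ (.y 0)).symm.trans hy) (by simp only [VGen.parity]; decide)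

end
end

section
/- Let φ : V̂_τ → ℤ/2ℤ be the group homomorphism with φ(x_n) = φ(π_n) = 0 for n ≥ 0, φ(c_n) = 0 for n ≥ 1, and φ(y_n) = 1 for n ≥ 0. Then the kernel V_xz of φ is a simple group. -/
/-!
STATEMENT 10: Let `φ : V̂_τ → ℤ/2ℤ` be the group homomorphism with `φ(x_n) = φ(π_n) = 0`
(n ≥ 0), `φ(c_n) = 0` (n ≥ 1) and `φ(y_n) = 1` (n ≥ 0).  Then the kernel `V_xz` of `φ` is a
simple group.  (ℤ/2ℤ is taken in multiplicative notation as `Multiplicative (ZMod 2)`.)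
-/

noncomputable section

namespace VTau

/-! ### A bijective model -/

/-- The inverse golden ratio. -/
def tau : ℝ := -Real.goldenConj

lemma tau_sq : tau ^ 2 = 1 - tau := by
  have := Real.goldenConj_sq
  unfold tau
  linear_combination this

lemma tau_pos : 0 < tau := by
  have := Real.goldenConj_neg
  unfold tau
  linarith

lemma tau_lt_one : tau < 1 := by
  have := Real.neg_one_lt_goldenConj
  unfold tau
  linarith

/-- The half-open unit interval. -/
abbrev Om : Type := Set.Ico (0 : ℝ) 1

/-- The left endpoint of the unit interval. -/
def zr : Om := ⟨0, by simp⟩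

/-- The affine contraction of the unit interval onto `[0, τ)`. -/
def lo (u : Om) : Om :=
  ⟨tau * u.1, mul_nonneg tau_pos.le u.2.1, by
    have := u.2.1; have := u.2.2; have := tau_pos; have := tau_lt_one; nlinarith⟩

/-- The affine contraction of the unit interval onto `[τ², 1)`. -/
def hi (u : Om) : Om :=
  ⟨1 - tau * (1 - u.1), by
    have := u.2.1; have := u.2.2; have := tau_pos; have := tau_lt_one
    constructor <;> nlinarith⟩

lemma lo_zr : lo zr = zr := by simp [lo, zr]

lemma lo_injective : Function.Injective lo := by
  intro u w h
  have := congrArg Subtype.val h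
  have ht := tau_pos.ne'
  simp only [lo, mul_eq_mul_left_iff, ht, or_false] at this
  exact Subtype.ext this

lemma hi_injective : Function.Injective hi := by
  intro u w h
  have := congrArg Subtype.val h
  have ht := tau_pos.ne'
  simp only [hi, sub_right_inj, mul_eq_mul_left_iff, ht, or_false] at this
  exact Subtype.ext this

lemma hi_lo_lo (u : Om) : hi (lo (lo u)) = lo (hi (hi u)) := by
  apply Subtype.ext
  simp only [hi, lo]
  linear_combination (tau - 1) * tau_sq

lemma lo_lo_val (u : Om) : (lo (lo u)).1 = (1 - tau) * u.1 := by
  simp only [lo]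
  linear_combination u.1 * tau_sq

lemma hi_hi_val (u : Om) : (hi (hi u)).1 = 1 - (1 - tau) * (1 - u.1) := by
  simp only [hi]
  linear_combination -(1 - u.1) * tau_sq

lemma lo_ne_hi_hi (u w : Om) : lo u ≠ hi (hi w) := by
  intro h
  have h := congrArg Subtype.val h
  rw [hi_hi_val] at h
  simp only [lo] at h
  have := u.2.2; have := w.2.1; have := tau_pos; have := tau_lt_one
  nlinarith

lemma lo_lo_ne_hi (u w : Om) : lo (lo u) ≠ hi w := by
  intro h
  have h := congrArg Subtype.val h
  rw [lo_lo_val] at h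
  simp only [hi] at h
  have := u.2.2; have := w.2.1; have := tau_pos; have := tau_lt_one
  nlinarith

lemma lo_or_hi_hi (u : Om) : (∃ w, u = lo w) ∨ ∃ w, u = hi (hi w) := by
  have h0 := tau_pos
  have h1 : 0 < 1 - tau := by linarith [tau_lt_one]
  have hu := u.2
  rcases lt_or_ge u.1 tau with h | h
  · refine Or.inl ⟨⟨u.1 / tau, div_nonneg hu.1 h0.le, (div_lt_one h0).2 h⟩, Subtype.ext ?_⟩
    simp only [lo]
    field_simp
  · refine Or.inr ⟨⟨1 - (1 - u.1) / (1 - tau), ?_, ?_⟩, Subtype.ext ?_⟩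
    · have : (1 - u.1) / (1 - tau) ≤ 1 := (div_le_one h1).2 (by linarith)
      linarith
    · have : 0 < (1 - u.1) / (1 - tau) := div_pos (by linarith [hu.2]) h1
      linarith
    · rw [hi_hi_val]
      field_simp
      ring

lemma lo_lo_or_hi (u : Om) : (∃ w, u = lo (lo w)) ∨ ∃ w, u = hi w := by
  rcases lo_or_hi_hi u with ⟨w, rfl⟩ | ⟨w, rfl⟩
  · rcases lo_or_hi_hi w with ⟨w, rfl⟩ | ⟨w, rfl⟩
    · exact Or.inl ⟨w, rfl⟩
    · exact Or.inr ⟨_, (hi_lo_lo w).symm⟩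
  · exact Or.inr ⟨_, rfl⟩

/-- The left half of a caret; `false` stands for `x`-carets, `true` for `y`-carets. -/
def lft (a : Bool) (u : Om) : Om := cond a (lo u) (lo (lo u))

/-- The right half of a caret; `false` stands for `x`-carets, `true` for `y`-carets. -/
def rgt (a : Bool) (u : Om) : Om := cond a (hi (hi u)) (hi u)

lemma lft_zr (a : Bool) : lft a zr = zr := by cases a <;> simp [lft, lo_zr]

lemma lft_inj {a : Bool} {u w : Om} : lft a u = lft a w ↔ u = w := by
  cases a <;> simp [lft, lo_injective.eq_iff]

lemma rgt_inj {a : Bool} {u w : Om} : rgt a u = rgt a w ↔ u = w := by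
  cases a <;> simp [rgt, hi_injective.eq_iff]

lemma lft_ne_rgt (a : Bool) (u w : Om) : lft a u ≠ rgt a w := by
  cases a
  · exact lo_lo_ne_hi u w
  · exact lo_ne_hi_hi u w

lemma lft_or_rgt (a : Bool) (u : Om) : (∃ w, u = lft a w) ∨ ∃ w, u = rgt a w := by
  cases a
  · exact lo_lo_or_hi u
  · exact lo_or_hi_hi u

/-- The piece number `k` of the infinite right vine. -/
def vn (p : ℕ × Om) : Om := hi^[p.1] (lo (lo p.2))

@[simp] lemma vn_zero (u : Om) : vn (0, u) = lo (lo u) := rfl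

@[simp] lemma vn_succ (k : ℕ) (u : Om) : vn (k + 1, u) = hi (vn (k, u)) := by
  simp [vn, Function.iterate_succ_apply']

lemma vn_injective : Function.Injective vn := by
  rintro ⟨k, u⟩ ⟨l, w⟩ h
  induction k generalizing l with
  | zero =>
    cases l with
    | zero => simpa [lo_injective.eq_iff] using h
    | succ l => exact absurd h (by simpa using lo_lo_ne_hi _ _)
  | succ k ih =>
    cases l with
    | zero => exact absurd h.symm (by simpa using lo_lo_ne_hi _ _)
    | succ l =>
      rw [vn_succ, vn_succ, hi_injective.eq_iff] at h
      have := ih l h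
      simp only [Prod.mk.injEq] at this ⊢
      exact ⟨by rw [this.1], this.2⟩

lemma vn_surjective : Function.Surjective vn := by
  have key : ∀ (n : ℕ) (u : Om), tau ^ n ≤ 1 - u.1 → ∃ p, vn p = u := by
    intro n
    induction n with
    | zero =>
      intro u hu
      refine ⟨(0, zr), Subtype.ext ?_⟩
      rw [vn_zero, lo_zr, lo_zr]
      have := u.2.1
      simp only [zr]
      linarith [pow_zero tau]
    | succ n ih =>
      intro u hu
      rcases lo_lo_or_hi u with ⟨w, rfl⟩ | ⟨w, rfl⟩
      · exact ⟨(0, w), rfl⟩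
      · simp only [hi, pow_succ] at hu
        obtain ⟨⟨k, z⟩, rfl⟩ := ih w (le_of_mul_le_mul_right (by linarith) tau_pos)
        exact ⟨(k + 1, z), by simp⟩
  intro u
  obtain ⟨n, hn⟩ := exists_pow_lt_of_lt_one (show 0 < 1 - u.1 by linarith [u.2.2]) tau_lt_one
  exact key n u hn.le

/-- The decomposition of the unit interval into the pieces of the infinite right vine. -/
def ve : ℕ × Om ≃ Om := Equiv.ofBijective vn ⟨vn_injective, vn_surjective⟩

@[simp] lemma ve_zero (u : Om) : ve (0, u) = lo (lo u) := rfl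

@[simp] lemma ve_succ (k : ℕ) (u : Om) : ve (k + 1, u) = hi (ve (k, u)) := vn_succ k u

lemma ve_symm_lo_lo (u : Om) : ve.symm (lo (lo u)) = (0, u) := by
  rw [Equiv.symm_apply_eq, ve_zero]

lemma ve_symm_hi (u : Om) : ve.symm (hi u) = ((ve.symm u).1 + 1, (ve.symm u).2) := by
  rw [Equiv.symm_apply_eq, ve_succ]
  simp

lemma ve_symm_zr : ve.symm zr = (0, zr) := by
  rw [← ve_symm_lo_lo zr, lo_zr, lo_zr]

/-- The underlying function of `mg`. -/
def mgf (a : Bool) (i : ℕ) (p : ℕ × Om) : ℕ × Om :=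
  if p.1 < i then p else if p.1 = i then (i, lft a p.2)
    else if p.1 = i + 1 then (i, rgt a p.2) else (p.1 - 1, p.2)

lemma mgf_bijective (a : Bool) (i : ℕ) : Function.Bijective (mgf a i) := by
  constructor
  · rintro ⟨k, u⟩ ⟨l, w⟩ h
    simp only [mgf] at h
    split_ifs at h <;> simp only [Prod.mk.injEq, lft_inj, rgt_inj] at h ⊢ <;>
      first
      | exact absurd h.2 (lft_ne_rgt _ _ _)
      | exact absurd h.2.symm (lft_ne_rgt _ _ _)
      | exact absurd h.1 (by omega)
      | exact ⟨by omega, h.2⟩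
  · rintro ⟨k, u⟩
    rcases lt_trichotomy k i with h | rfl | h
    · exact ⟨(k, u), by simp [mgf, h]⟩
    · rcases lft_or_rgt a u with ⟨w, rfl⟩ | ⟨w, rfl⟩
      · exact ⟨(k, w), by simp [mgf]⟩
      · exact ⟨(k + 1, w), by simp [mgf]⟩
    · refine ⟨(k + 1, u), ?_⟩
      rw [mgf, if_neg (by simp; omega), if_neg (by simp; omega), if_neg (by simp; omega)]
      simp

/-- Merging the components `i` and `i + 1` into the component `i` by a caret of type `a`. -/
def mg (a : Bool) (i : ℕ) : Equiv.Perm (ℕ × Om) := Equiv.ofBijective _ (mgf_bijective a i)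

lemma mg_apply (a : Bool) (i k : ℕ) (u : Om) : mg a i (k, u) =
    if k < i then (k, u) else if k = i then (i, lft a u)
    else if k = i + 1 then (i, rgt a u) else (k - 1, u) := rfl

/-- Exchanging the components `i` and `i + 1`. -/
def sw (i : ℕ) : Equiv.Perm (ℕ × Om) := (Equiv.swap i (i + 1)).prodCongr (Equiv.refl _)

lemma sw_apply (i k : ℕ) (u : Om) : sw i (k, u) =
    if k = i then (i + 1, u) else if k = i + 1 then (i, u) else (k, u) := by
  simp only [sw, Equiv.prodCongr_apply, Prod.map, Equiv.swap_apply_def, Equiv.refl_apply]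
  split_ifs <;> rfl

/-- The cyclic rotation of the components `0, …, n + 1` and of the remaining components. -/
def rot (n : ℕ) : Equiv.Perm (ℕ × Om) where
  toFun p := if p.1 = 0 then (n + 2 + (ve.symm p.2).1, (ve.symm p.2).2)
    else if p.1 ≤ n + 1 then (p.1 - 1, p.2) else (n + 1, ve (p.1 - (n + 2), p.2))
  invFun p := if p.1 ≤ n then (p.1 + 1, p.2)
    else if p.1 = n + 1 then (n + 2 + (ve.symm p.2).1, (ve.symm p.2).2)
    else (0, ve (p.1 - (n + 2), p.2))
  left_inv := by
    rintro ⟨k, u⟩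
    rcases Nat.eq_zero_or_pos k with rfl | h0
    · simp [show ¬ n + 2 + (ve.symm u).1 ≤ n by omega, show n + 2 + (ve.symm u).1 ≠ n + 1 by omega]
    · rcases le_or_gt k (n + 1) with h | h
      · simp [h0.ne', h, show k - 1 ≤ n by omega, show k - 1 + 1 = k by omega]
      · simp [h0.ne', h.not_ge, show n + 2 + (k - (n + 2)) = k by omega]
  right_inv := by
    rintro ⟨k, u⟩
    rcases le_or_gt k n with h | h
    · simp [h]
    · rcases Nat.eq_or_lt_of_le (Nat.succ_le_of_lt h) with rfl | h'
      · simp [show ¬ n + 2 + (ve.symm u).1 ≤ n + 1 by omega]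
      · have h1 : ¬ k ≤ n := by omega
        have h2 : k ≠ n + 1 := by omega
        simp [h1, h2, show n + 2 + (k - (n + 2)) = k by omega]

lemma rot_apply (n k : ℕ) (u : Om) : rot n (k, u) =
    if k = 0 then (n + 2 + (ve.symm u).1, (ve.symm u).2)
    else if k ≤ n + 1 then (k - 1, u) else (n + 1, ve (k - (n + 2), u)) := rfl

/-! ### The defining relations hold in the model -/

lemma mg_lt {a : Bool} {i k : ℕ} {u : Om} (h : k < i) : mg a i (k, u) = (k, u) := by
  simp [mg_apply, h]

lemma mg_eq {a : Bool} {i k : ℕ} {u : Om} (h : k = i) : mg a i (k, u) = (i, lft a u) := by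
  simp [mg_apply, h]

lemma mg_succ {a : Bool} {i k : ℕ} {u : Om} (h : k = i + 1) : mg a i (k, u) = (i, rgt a u) := by
  simp [mg_apply, h]

lemma mg_gt {a : Bool} {i k : ℕ} {u : Om} (h : i + 1 < k) : mg a i (k, u) = (k - 1, u) := by
  simp [mg_apply, show ¬ k < i by omega, show k ≠ i by omega, show k ≠ i + 1 by omega]

lemma sw_left {i k : ℕ} {u : Om} (h : k = i) : sw i (k, u) = (i + 1, u) := by
  simp [sw_apply, h]

lemma sw_right {i k : ℕ} {u : Om} (h : k = i + 1) : sw i (k, u) = (i, u) := by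
  simp [sw_apply, h]

lemma sw_ne {i k : ℕ} {u : Om} (h : k < i ∨ i + 1 < k) : sw i (k, u) = (k, u) := by
  simp [sw_apply, show k ≠ i by omega, show k ≠ i + 1 by omega]

lemma rot_first {n k : ℕ} {u : Om} (h : k = 0) :
    rot n (k, u) = (n + 2 + (ve.symm u).1, (ve.symm u).2) := by
  simp [rot_apply, h]

lemma rot_mid {n k : ℕ} {u : Om} (h : 0 < k ∧ k ≤ n + 1) : rot n (k, u) = (k - 1, u) := by
  simp [rot_apply, h.1.ne', h.2]

lemma rot_last {n k : ℕ} {u : Om} (h : n + 1 < k) :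
    rot n (k, u) = (n + 1, ve (k - (n + 2), u)) := by
  simp [rot_apply, show k ≠ 0 by omega, show ¬ k ≤ n + 1 by omega]

lemma mg_mul_mg {i j : ℕ} (h : i < j) (a b : Bool) :
    mg a j * mg b i = mg b i * mg a (j + 1) := by
  ext1 ⟨k, u⟩
  simp only [Equiv.Perm.mul_apply]
  have : k < i ∨ k = i ∨ k = i + 1 ∨ (i + 1 < k ∧ k < j + 1) ∨ k = j + 1 ∨ k = j + 2 ∨
    j + 2 < k := by omega
  rcases this with h | h | h | h | h | h | h <;>
    simp (disch := omega) only [mg_lt, mg_eq, mg_succ, mg_gt]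
  all_goals simp

lemma rgt_false_lft (u : Om) : rgt false (lft false u) = lft true (rgt true u) := hi_lo_lo u

lemma mg_true_sq (n : ℕ) : mg true n ^ 2 = mg false n * mg false (n + 1) := by
  ext1 ⟨k, u⟩
  simp only [Equiv.Perm.mul_apply, pow_two]
  have : k < n ∨ k = n ∨ k = n + 1 ∨ k = n + 2 ∨ n + 2 < k := by omega
  rcases this with h | h | h | h | h <;>
    simp (disch := omega) only [mg_lt, mg_eq, mg_succ, mg_gt]
  · rfl
  · rw [rgt_false_lft]
  · rfl

lemma sw_mul_mg_of_le {i j : ℕ} (h : i + 2 ≤ j) (a : Bool) : sw i * mg a j = mg a j * sw i := by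
  ext1 ⟨k, u⟩
  simp only [Equiv.Perm.mul_apply]
  have : k < i ∨ k = i ∨ k = i + 1 ∨ (i + 1 < k ∧ k < j) ∨ k = j ∨ k = j + 1 ∨ j + 1 < k := by
    omega
  rcases this with h | h | h | h | h | h | h <;>
    simp (disch := omega) only [mg_lt, mg_eq, mg_succ, mg_gt, sw_left, sw_right, sw_ne]

lemma sw_mul_mg_succ (i : ℕ) (a : Bool) :
    sw i * mg a (i + 1) = mg a i * sw (i + 1) * sw i := by
  ext1 ⟨k, u⟩
  simp only [Equiv.Perm.mul_apply]
  have : k < i ∨ k = i ∨ k = i + 1 ∨ k = i + 2 ∨ i + 2 < k := by omega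
  rcases this with h | h | h | h | h <;>
    simp (disch := omega) only [mg_lt, mg_eq, mg_succ, mg_gt, sw_left, sw_right, sw_ne]
  simp

lemma sw_mul_mg_self (i : ℕ) (a : Bool) :
    sw i * mg a i = mg a (i + 1) * sw i * sw (i + 1) := by
  ext1 ⟨k, u⟩
  simp only [Equiv.Perm.mul_apply]
  have : k < i ∨ k = i ∨ k = i + 1 ∨ k = i + 2 ∨ i + 2 < k := by omega
  rcases this with h | h | h | h | h <;>
    simp (disch := omega) only [mg_lt, mg_eq, mg_succ, mg_gt, sw_left, sw_right, sw_ne]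

lemma sw_mul_mg_of_lt {i j : ℕ} (h : j < i) (a : Bool) :
    sw i * mg a j = mg a j * sw (i + 1) := by
  ext1 ⟨k, u⟩
  simp only [Equiv.Perm.mul_apply]
  have : k < j ∨ k = j ∨ k = j + 1 ∨ (j + 1 < k ∧ k < i + 1) ∨ k = i + 1 ∨ k = i + 2 ∨
    i + 2 < k := by omega
  rcases this with h | h | h | h | h | h | h <;>
    simp (disch := omega) only [mg_lt, mg_eq, mg_succ, mg_gt, sw_left, sw_right, sw_ne]
  all_goals simp

lemma sw_mul_sw {i j : ℕ} (h : i + 2 ≤ j) : sw i * sw j = sw j * sw i := by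
  ext1 ⟨k, u⟩
  simp only [Equiv.Perm.mul_apply]
  have : k < i ∨ k = i ∨ k = i + 1 ∨ (i + 1 < k ∧ k < j) ∨ k = j ∨ k = j + 1 ∨ j + 1 < k := by
    omega
  rcases this with h | h | h | h | h | h | h <;>
    simp (disch := omega) only [sw_left, sw_right, sw_ne]

lemma sw_sq (i : ℕ) : sw i ^ 2 = 1 := by
  ext1 ⟨k, u⟩
  simp only [Equiv.Perm.mul_apply, pow_two, Equiv.Perm.one_apply]
  have : k < i ∨ k = i ∨ k = i + 1 ∨ i + 1 < k := by omega
  rcases this with h | h | h | h <;>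
    simp (disch := omega) only [sw_left, sw_right, sw_ne, h]

lemma sw_cube (i : ℕ) : (sw (i + 1) * sw i) ^ 3 = 1 := by
  ext1 ⟨k, u⟩
  simp only [Equiv.Perm.mul_apply, pow_succ, pow_zero, Equiv.Perm.one_apply]
  have : k < i ∨ k = i ∨ k = i + 1 ∨ k = i + 2 ∨ i + 2 < k := by omega
  rcases this with h | h | h | h | h <;>
    simp (disch := omega) only [sw_left, sw_right, sw_ne, h]

lemma rot_eq (n : ℕ) : rot n = mg false (n + 1) * rot (n + 1) := by
  ext1 ⟨k, u⟩
  simp only [Equiv.Perm.mul_apply]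
  have : k = 0 ∨ (0 < k ∧ k ≤ n + 1) ∨ k = n + 2 ∨ n + 2 < k := by omega
  rcases this with h | h | h | h <;>
    simp (disch := omega) only [mg_lt, mg_eq, mg_succ, mg_gt, rot_first, rot_mid, rot_last]
  · simp only [Prod.mk.injEq, and_true]; omega
  · simp [h, lft]
  · obtain ⟨m, rfl⟩ := Nat.exists_eq_add_of_lt h
    rw [show n + 2 + m + 1 - (n + 2) = m + 1 by omega,
      show n + 2 + m + 1 - (n + 1 + 2) = m by omega]
    simp [rgt]

lemma rot_mul_mg {n k : ℕ} (hk : 1 ≤ k) (hn : k < n + 1) (a : Bool) :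
    mg a k * rot (n + 1) = rot n * mg a (k + 1) := by
  ext1 ⟨l, u⟩
  simp only [Equiv.Perm.mul_apply]
  have : l = 0 ∨ (0 < l ∧ l < k + 1) ∨ l = k + 1 ∨ l = k + 2 ∨ (k + 2 < l ∧ l ≤ n + 2) ∨
    n + 2 < l := by omega
  rcases this with h | h | h | h | h | h <;>
    simp (disch := omega) only [mg_lt, mg_eq, mg_succ, mg_gt, rot_first, rot_mid, rot_last]
  · simp only [Prod.mk.injEq, and_true]; omega
  · simp
  · simp
  · simp only [Prod.mk.injEq]
    exact ⟨by omega, by rw [show l - (n + 1 + 2) = l - 1 - (n + 2) by omega]⟩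

lemma rot_mul_mg_false_zero (n : ℕ) : rot n * mg false 0 = rot (n + 1) ^ 2 := by
  ext1 ⟨k, u⟩
  simp only [Equiv.Perm.mul_apply, pow_two]
  have : k = 0 ∨ k = 1 ∨ (1 < k ∧ k ≤ n + 2) ∨ n + 2 < k := by omega
  rcases this with h | h | h | h <;>
    simp (disch := omega) only [mg_eq, mg_succ, mg_gt, rot_first, rot_mid, rot_last]
  · rw [show n + 1 + 2 + (ve.symm u).1 - (n + 1 + 2) = (ve.symm u).1 by omega]
    simp [lft, ve_symm_lo_lo]
  · subst h
    simp only [rgt, cond_false, ve_symm_hi]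
    simp only [Prod.mk.injEq, and_true]; omega
  · simp only [Prod.mk.injEq, Nat.add_sub_cancel]
    exact ⟨trivial, by rw [show k - (n + 1 + 2) = k - 1 - (n + 2) by omega]⟩

lemma mg_true_ve_symm (n : ℕ) (u : Om) :
    mg true n (n + (ve.symm (lo u)).1, (ve.symm (lo u)).2) = (n, u) := by
  rcases lo_or_hi_hi u with ⟨w, rfl⟩ | ⟨w, rfl⟩
  · rw [ve_symm_lo_lo]
    exact mg_eq rfl
  · rw [← hi_lo_lo, ve_symm_hi, ve_symm_lo_lo]
    exact mg_succ rfl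

lemma rot_mul_mg_true_zero (n : ℕ) :
    mg true (n + 2) * (rot n * mg true 0) = rot (n + 1) ^ 2 := by
  ext1 ⟨k, u⟩
  simp only [Equiv.Perm.mul_apply, pow_two]
  have : k = 0 ∨ k = 1 ∨ (1 < k ∧ k ≤ n + 2) ∨ n + 2 < k := by omega
  rcases this with h | h | h | h <;>
    simp (disch := omega) only [mg_lt, mg_eq, mg_succ, mg_gt, rot_first, rot_mid, rot_last]
  · rw [show n + 1 + 2 + (ve.symm u).1 - (n + 1 + 2) = (ve.symm u).1 by omega]
    simp [lft, mg_true_ve_symm]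
  · subst h
    simp only [rgt, cond_true, ve_symm_hi]
    rw [mg_gt (by omega)]
    simp only [Prod.mk.injEq, and_true]; omega
  · simp only [Prod.mk.injEq, Nat.add_sub_cancel]
    exact ⟨trivial, by rw [show k - (n + 1 + 2) = k - 1 - (n + 2) by omega]⟩

/-- The leaf number `j` of the right vine with `n + 3` leaves. -/
def leaf (n j : ℕ) (u : Om) : ℕ × Om :=
  if j < n + 2 then (j, u) else (n + 2 + (ve.symm u).1, (ve.symm u).2)

lemma leaf_of_lt {n j : ℕ} (h : j < n + 2) (u : Om) : leaf n j u = (j, u) := if_pos h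

lemma leaf_last {n j : ℕ} (h : j = n + 2) (u : Om) :
    leaf n j u = (n + 2 + (ve.symm u).1, (ve.symm u).2) := if_neg (by omega)

lemma leaf_zr {n j : ℕ} (h : j ≤ n + 2) : leaf n j zr = (j, zr) := by
  rcases Nat.lt_or_eq_of_le h with h | h
  · exact leaf_of_lt h _
  · rw [leaf_last h, ve_symm_zr]
    simp [h]

lemma exists_leaf (n : ℕ) (p : ℕ × Om) : ∃ j ≤ n + 2, ∃ u, leaf n j u = p := by
  obtain ⟨k, u⟩ := p
  rcases lt_or_ge k (n + 2) with h | h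
  · exact ⟨k, h.le, u, leaf_of_lt h u⟩
  · refine ⟨n + 2, le_rfl, ve (k - (n + 2), u), ?_⟩
    rw [leaf_last rfl]
    simp [h]

lemma perm_ext_leaf (n : ℕ) {f g : Equiv.Perm (ℕ × Om)}
    (h : ∀ j ≤ n + 2, ∀ u, f (leaf n j u) = g (leaf n j u)) : f = g := by
  ext1 p
  obtain ⟨j, hj, u, rfl⟩ := exists_leaf n p
  exact h j hj u

lemma rot_leaf_zero {n k : ℕ} (h : k = 0) (u : Om) : rot n (leaf n k u) = leaf n (n + 2) u := by
  rw [leaf_of_lt (by omega), rot_first h, leaf_last rfl]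

lemma rot_leaf {n j : ℕ} (h : 0 < j ∧ j ≤ n + 2) (u : Om) :
    rot n (leaf n j u) = leaf n (j - 1) u := by
  rcases Nat.lt_or_eq_of_le h.2 with h' | h'
  · rw [leaf_of_lt h', leaf_of_lt (by omega), rot_mid (by omega)]
  · rw [leaf_last h', leaf_of_lt (by omega), rot_last (by omega)]
    simp [h']

lemma rot_pow_leaf {n : ℕ} (k : ℕ) {j : ℕ} (hj : j ≤ n + 2) (hk : k ≤ j) (u : Om) :
    (rot n ^ k) (leaf n j u) = leaf n (j - k) u := by
  induction k with
  | zero => rfl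
  | succ k ih =>
    rw [pow_succ', Equiv.Perm.mul_apply, ih (by omega), rot_leaf (by omega)]
    rfl

lemma rot_pow (n : ℕ) : rot n ^ (n + 3) = 1 := by
  refine perm_ext_leaf n fun j hj u => ?_
  rw [show n + 3 = (n + 2 - j) + 1 + j by omega, pow_add, pow_succ, Equiv.Perm.mul_apply,
    Equiv.Perm.mul_apply, rot_pow_leaf j hj le_rfl, rot_leaf_zero (by omega),
    rot_pow_leaf _ le_rfl (by omega), show n + 2 - (n + 2 - j) = j by omega]
  rfl

lemma sw_leaf_left {n i k : ℕ} (h : k = i) (hi : i ≤ n) (u : Om) :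
    sw i (leaf n k u) = leaf n (i + 1) u := by
  rw [leaf_of_lt (by omega), leaf_of_lt (by omega), sw_left h]

lemma sw_leaf_right {n i k : ℕ} (h : k = i + 1) (hi : i ≤ n) (u : Om) :
    sw i (leaf n k u) = leaf n i u := by
  rw [leaf_of_lt (by omega), leaf_of_lt (by omega), sw_right h]

lemma sw_leaf_ne {n i k : ℕ} (h : k < i ∨ i + 1 < k) (hi : i ≤ n) (hk : k ≤ n + 2) (u : Om) :
    sw i (leaf n k u) = leaf n k u := by
  rcases Nat.lt_or_eq_of_le hk with hk | hk
  · rw [leaf_of_lt hk, sw_ne h]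
  · rw [leaf_last hk, sw_ne (by omega)]

lemma rot_mul_sw {n k : ℕ} (hk : 1 ≤ k) (hn : k ≤ n) : rot n * sw k = sw (k - 1) * rot n := by
  refine perm_ext_leaf n fun j hj u => ?_
  simp only [Equiv.Perm.mul_apply]
  have : j = 0 ∨ (0 < j ∧ j < k) ∨ j = k ∨ j = k + 1 ∨ k + 1 < j := by omega
  rcases this with h | h | h | h | h <;>
    simp (disch := omega) only [rot_leaf_zero, rot_leaf, sw_leaf_left, sw_leaf_right, sw_leaf_ne]
  all_goals simp [hk]

lemma rot_cube_mul_sw (n : ℕ) : rot n ^ 3 * sw 0 = sw n * rot n ^ 3 := by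
  refine perm_ext_leaf n fun j hj u => ?_
  simp only [Equiv.Perm.mul_apply, pow_succ, pow_zero, Equiv.Perm.one_apply]
  have : j = 0 ∨ j = 1 ∨ j = 2 ∨ 3 ≤ j := by omega
  rcases this with h | h | h | h <;>
    simp (disch := omega) only [rot_leaf_zero, rot_leaf, sw_leaf_left, sw_leaf_right, sw_leaf_ne]
  all_goals simp

lemma sw_prod_leaf (n : ℕ) {m : ℕ} (hm : m ≤ n + 1) {j : ℕ} (hj : j ≤ n + 2) (u : Om) :
    ((List.range m).map sw).prod (leaf n j u) =
      leaf n (if j = m then 0 else if j < m then j + 1 else j) u := by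
  induction m generalizing j with
  | zero =>
    simp only [List.range_zero, List.map_nil, List.prod_nil, Equiv.Perm.one_apply]
    split_ifs <;> simp_all
  | succ m ih =>
    rw [List.range_succ, List.map_append, List.prod_append, Equiv.Perm.mul_apply]
    simp only [List.map_cons, List.map_nil, List.prod_cons, List.prod_nil, mul_one]
    have : j < m ∨ j = m ∨ j = m + 1 ∨ m + 1 < j := by omega
    rcases this with h | h | h | h <;>
      simp (disch := omega) only [sw_leaf_left, sw_leaf_right, sw_leaf_ne, ih]
    all_goals
      congr 1
      split_ifs <;> omega

lemma rot_mul_sw_zero (n : ℕ) :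
    rot n * sw 0 = ((List.range (n + 1)).map sw).prod * rot n ^ 2 := by
  refine perm_ext_leaf n fun j hj u => ?_
  simp only [Equiv.Perm.mul_apply, pow_two]
  have : j = 0 ∨ j = 1 ∨ 2 ≤ j := by omega
  rcases this with h | h | h <;>
    simp (disch := omega) only [rot_leaf_zero, rot_leaf, sw_leaf_left, sw_leaf_right, sw_leaf_ne,
      sw_prod_leaf]
  all_goals
    congr 1
    split_ifs <;> omega

lemma sw_prod_reverse (m : ℕ) :
    ((List.range m).reverse.map sw).prod * ((List.range m).map sw).prod = 1 := by
  induction m with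
  | zero => simp
  | succ m ih =>
    rw [List.range_succ, List.reverse_append, List.map_append, List.map_append, List.prod_append,
      List.prod_append]
    simp only [List.reverse_cons, List.reverse_nil, List.nil_append, List.map_cons, List.map_nil,
      List.prod_cons, List.prod_nil, mul_one]
    have : ∀ a b c : Equiv.Perm (ℕ × Om), c * c = 1 → a * b = 1 → c * a * (b * c) = 1 := by
      intro a b c h1 h2
      rw [mul_assoc, ← mul_assoc a, h2, one_mul, h1]
    exact this _ _ _ (by rw [← pow_two, sw_sq]) ih

lemma rot_sq_mul_sw_zero (n : ℕ) :
    rot n ^ 2 * sw 0 = ((List.range (n + 1)).reverse.map sw).prod * rot n := by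
  have h1 := rot_mul_sw_zero n
  have h2 := sw_prod_reverse (n + 1)
  have h3 : sw 0 * sw 0 = 1 := by rw [← pow_two, sw_sq]
  calc rot n ^ 2 * sw 0
      = ((List.range (n + 1)).reverse.map sw).prod *
        (((List.range (n + 1)).map sw).prod * rot n ^ 2) * sw 0 := by
        rw [← mul_assoc (List.prod _), h2, one_mul]
    _ = _ := by rw [← h1, mul_assoc, mul_assoc, h3, mul_one]

/-- The permutations that model the generators. -/
def genPerm : VGen → Equiv.Perm (ℕ × Om)
  | VGen.x n => mg false n
  | VGen.y n => mg true n
  | VGen.p n => sw n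
  | VGen.c n => rot n.natPred

lemma natPred_spec (n : ℕ+) : ∃ m : ℕ, n = m.succPNat := ⟨n.natPred, n.succPNat_natPred.symm⟩

lemma succPNat_add_one (m : ℕ) : m.succPNat + 1 = (m + 1).succPNat := rfl

lemma lift_genPerm (r : FreeGroup VGen) (hr : r ∈ VGen.VRels) : FreeGroup.lift genPerm r = 1 := by
  have hX : ∀ n, FreeGroup.lift genPerm (VGen.X n) = mg false n := fun n => by
    simp [VGen.X, genPerm]
  have hY : ∀ n, FreeGroup.lift genPerm (VGen.Y n) = mg true n := fun n => by simp [VGen.Y, genPerm]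
  have hP : ∀ n, FreeGroup.lift genPerm (VGen.P n) = sw n := fun n => by simp [VGen.P, genPerm]
  have hC : ∀ n : ℕ, FreeGroup.lift genPerm (VGen.C n.succPNat) = rot n := fun n => by
    simp [VGen.C, genPerm]
  have hM : ∀ l : List ℕ, FreeGroup.lift genPerm (l.map VGen.P).prod = (l.map sw).prod := by
    intro l
    rw [map_list_prod, List.map_map]
    exact congrArg _ (List.map_congr_left fun n _ => hP n)
  have key : ∀ a b : FreeGroup VGen, FreeGroup.lift genPerm a = FreeGroup.lift genPerm b →
      FreeGroup.lift genPerm (a * b⁻¹) = 1 := by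
    intro a b h
    rw [map_mul, map_inv, h, mul_inv_cancel]
  simp only [VGen.VRels, Set.mem_union, Set.mem_iUnion, Set.mem_insert_iff,
    Set.mem_singleton_iff] at hr
  rcases hr with (((((((h | h) | h) | h) | h) | h) | h) | h) | h
  · obtain ⟨i, j, h, rfl | rfl | rfl | rfl⟩ := h <;> apply key <;>
      simp only [map_mul, hX, hY, mg_mul_mg h]
  · obtain ⟨n, rfl⟩ := h
    apply key
    simp only [map_mul, map_pow, hX, hY, mg_true_sq]
  · obtain ⟨k, n, hk, hn, h⟩ := h
    obtain ⟨m, rfl⟩ := natPred_spec n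
    rcases h with rfl | rfl <;> apply key <;> rw [succPNat_add_one] <;>
      simp only [map_mul, hX, hY, hC] <;> exact rot_mul_mg hk hn _
  · obtain ⟨n, h⟩ := h
    obtain ⟨m, rfl⟩ := natPred_spec n
    rw [succPNat_add_one] at h
    rcases h with rfl | rfl | rfl | rfl
    · apply key
      simp only [map_mul, map_pow, hX, hC, rot_mul_mg_false_zero]
    · apply key
      simp only [map_mul, hX, hC]
      exact rot_eq m
    · simp only [map_pow, hC]
      exact rot_pow m
    · apply key
      simp only [map_mul, map_pow, map_inv, hY, hC]
      rw [← rot_mul_mg_true_zero]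
      exact (inv_mul_cancel_left _ _).symm
  · obtain ⟨i, j, h, rfl | rfl | rfl⟩ := h <;> apply key <;>
      simp only [map_mul, hX, hY, hP, sw_mul_mg_of_le h, sw_mul_sw h]
  · obtain ⟨i, rfl | rfl | rfl | rfl | rfl | rfl⟩ := h
    · apply key
      simp only [map_mul, hX, hP, sw_mul_mg_succ]
    · apply key
      simp only [map_mul, hX, hP, sw_mul_mg_self]
    · simp only [map_pow, hP, sw_sq]
    · simp only [map_mul, map_pow, hP, sw_cube]
    · apply key
      simp only [map_mul, hY, hP, sw_mul_mg_succ]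
    · apply key
      simp only [map_mul, hY, hP, sw_mul_mg_self]
  · obtain ⟨i, j, h, rfl | rfl⟩ := h <;> apply key <;>
      simp only [map_mul, hX, hY, hP, sw_mul_mg_of_lt h]
  · obtain ⟨n, k, hk, hn, rfl⟩ := h
    obtain ⟨m, rfl⟩ := natPred_spec n
    apply key
    simp only [map_mul, hP, hC]
    exact rot_mul_sw hk hn
  · obtain ⟨n, h⟩ := h
    obtain ⟨m, rfl⟩ := natPred_spec n
    rcases h with rfl | rfl | rfl <;> apply key <;> simp only [map_mul, map_pow, hP, hC, hM]
    · exact rot_mul_sw_zero m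
    · exact rot_sq_mul_sw_zero m
    · exact rot_cube_mul_sw m

/-- The action of `V̂_τ` on the model. -/
def rho : VhatTau →* Equiv.Perm (ℕ × Om) := PresentedGroup.toGroup lift_genPerm

lemma rho_vpg (n : ℕ) : rho (vpg n) = sw n := PresentedGroup.toGroup.of lift_genPerm

/-- The generator `x_n` (for `a = false`) or `y_n` (for `a = true`). -/
def gl (a : Bool) (n : ℕ) : VhatTau := cond a (vyg n) (vxg n)

lemma rho_gl (a : Bool) (n : ℕ) : rho (gl a n) = mg a n := by
  cases a <;> exact PresentedGroup.toGroup.of lift_genPerm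

/-- The generator `c_{n+1}`, which rotates `n + 3` leaves. -/
def cg (n : ℕ) : VhatTau := vcg n.succPNat

lemma rho_cg (n : ℕ) : rho (cg n) = rot n := PresentedGroup.toGroup.of lift_genPerm

/-! ### The defining relations, in the abstract group -/

lemma mk_eq_of_rel {a b : FreeGroup VGen} (h : a * b⁻¹ ∈ VGen.VRels) :
    PresentedGroup.mk VGen.VRels a = PresentedGroup.mk VGen.VRels b :=
  PresentedGroup.mk_eq_mk_of_mul_inv_mem h

lemma gl_mul_gl {i j : ℕ} (h : i < j) (a b : Bool) : gl a j * gl b i = gl b i * gl a (j + 1) := by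
  have key : ∀ r ∈ ({VGen.X j * VGen.X i * (VGen.X i * VGen.X (j + 1))⁻¹,
      VGen.X j * VGen.Y i * (VGen.Y i * VGen.X (j + 1))⁻¹,
      VGen.Y j * VGen.X i * (VGen.X i * VGen.Y (j + 1))⁻¹,
      VGen.Y j * VGen.Y i * (VGen.Y i * VGen.Y (j + 1))⁻¹} : Set (FreeGroup VGen)),
      r ∈ VGen.VRels := by
    intro r hr
    simp only [VGen.VRels, Set.mem_union, Set.mem_iUnion]
    exact Or.inl (Or.inl (Or.inl (Or.inl (Or.inl (Or.inl (Or.inl (Or.inl ⟨i, j, h, hr⟩)))))))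
  cases a <;> cases b <;> exact mk_eq_of_rel (key _ (by simp [VGen.X, VGen.Y]))

lemma gl_true_sq (n : ℕ) : gl true n * gl true n = gl false n * gl false (n + 1) := by
  rw [← pow_two]
  refine mk_eq_of_rel (a := VGen.Y n ^ 2) (b := VGen.X n * VGen.X (n + 1)) ?_
  simp only [VGen.VRels, Set.mem_union, Set.mem_iUnion]
  exact Or.inl (Or.inl (Or.inl (Or.inl (Or.inl (Or.inl (Or.inl (Or.inr ⟨n, rfl⟩)))))))

lemma gl_mul_cg {k n : ℕ} (hk : 1 ≤ k) (hn : k < n + 1) (a : Bool) :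
    gl a k * cg (n + 1) = cg n * gl a (k + 1) := by
  have key : ∀ r ∈ ({VGen.X k * VGen.C (n.succPNat + 1) * (VGen.C n.succPNat * VGen.X (k + 1))⁻¹,
      VGen.Y k * VGen.C (n.succPNat + 1) * (VGen.C n.succPNat * VGen.Y (k + 1))⁻¹} :
      Set (FreeGroup VGen)), r ∈ VGen.VRels := by
    intro r hr
    simp only [VGen.VRels, Set.mem_union, Set.mem_iUnion]
    exact Or.inl (Or.inl (Or.inl (Or.inl (Or.inl (Or.inl (Or.inr ⟨k, n.succPNat, hk, hn, hr⟩))))))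
  cases a <;> exact mk_eq_of_rel (key _ (by simp [VGen.X, VGen.Y, VGen.C, succPNat_add_one]))

lemma mem_VRels_c (n : ℕ) : ∀ r ∈ ({VGen.C n.succPNat * VGen.X 0 * (VGen.C (n + 1).succPNat ^ 2)⁻¹,
    VGen.C n.succPNat * (VGen.X (n + 1) * VGen.C (n + 1).succPNat)⁻¹,
    VGen.C n.succPNat ^ (n + 3),
    VGen.C n.succPNat * VGen.Y 0 * ((VGen.Y (n + 2))⁻¹ * VGen.C (n + 1).succPNat ^ 2)⁻¹} :
    Set (FreeGroup VGen)), r ∈ VGen.VRels := by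
  intro r hr
  simp only [VGen.VRels, Set.mem_union, Set.mem_iUnion]
  exact Or.inl (Or.inl (Or.inl (Or.inl (Or.inl (Or.inr ⟨n.succPNat, hr⟩)))))

lemma cg_mul_gl_false_zero (n : ℕ) : cg n * gl false 0 = cg (n + 1) ^ 2 :=
  mk_eq_of_rel (mem_VRels_c n _ (by simp [VGen.X, VGen.Y, VGen.C]))

lemma cg_eq (n : ℕ) : cg n = gl false (n + 1) * cg (n + 1) :=
  mk_eq_of_rel (mem_VRels_c n _ (by simp [VGen.X, VGen.Y, VGen.C]))

lemma cg_pow (n : ℕ) : cg n ^ (n + 3) = 1 :=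
  PresentedGroup.one_of_mem (mem_VRels_c n _ (by simp [VGen.X, VGen.Y, VGen.C]))

lemma cg_mul_gl_true_zero (n : ℕ) : cg n * gl true 0 = (gl true (n + 2))⁻¹ * cg (n + 1) ^ 2 :=
  mk_eq_of_rel (mem_VRels_c n _ (by simp [VGen.X, VGen.Y, VGen.C]))

lemma mem_VRels_far {i j : ℕ} (h : i + 2 ≤ j) :
    ∀ r ∈ ({VGen.P i * VGen.X j * (VGen.X j * VGen.P i)⁻¹,
      VGen.P i * VGen.P j * (VGen.P j * VGen.P i)⁻¹,
      VGen.P i * VGen.Y j * (VGen.Y j * VGen.P i)⁻¹} : Set (FreeGroup VGen)), r ∈ VGen.VRels := by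
  intro r hr
  simp only [VGen.VRels, Set.mem_union, Set.mem_iUnion]
  exact Or.inl (Or.inl (Or.inl (Or.inl (Or.inr ⟨i, j, h, hr⟩))))

lemma vpg_mul_gl_of_le {i j : ℕ} (h : i + 2 ≤ j) (a : Bool) :
    vpg i * gl a j = gl a j * vpg i := by
  cases a <;> exact mk_eq_of_rel (mem_VRels_far h _ (by simp [VGen.X, VGen.Y, VGen.P]))

lemma vpg_mul_vpg {i j : ℕ} (h : i + 2 ≤ j) : vpg i * vpg j = vpg j * vpg i :=
  mk_eq_of_rel (mem_VRels_far h _ (by simp [VGen.X, VGen.Y, VGen.P]))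

lemma mem_VRels_near (i : ℕ) :
    ∀ r ∈ ({VGen.P i * VGen.X (i + 1) * (VGen.X i * VGen.P (i + 1) * VGen.P i)⁻¹,
      VGen.P i * VGen.X i * (VGen.X (i + 1) * VGen.P i * VGen.P (i + 1))⁻¹,
      VGen.P i ^ 2,
      (VGen.P (i + 1) * VGen.P i) ^ 3,
      VGen.P i * VGen.Y (i + 1) * (VGen.Y i * VGen.P (i + 1) * VGen.P i)⁻¹,
      VGen.P i * VGen.Y i * (VGen.Y (i + 1) * VGen.P i * VGen.P (i + 1))⁻¹} :
      Set (FreeGroup VGen)), r ∈ VGen.VRels := by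
  intro r hr
  simp only [VGen.VRels, Set.mem_union, Set.mem_iUnion]
  exact Or.inl (Or.inl (Or.inl (Or.inr ⟨i, hr⟩)))

lemma vpg_mul_gl_succ (i : ℕ) (a : Bool) :
    vpg i * gl a (i + 1) = gl a i * vpg (i + 1) * vpg i := by
  cases a <;> exact mk_eq_of_rel (mem_VRels_near i _ (by simp [VGen.X, VGen.Y, VGen.P]))

lemma vpg_mul_gl_self (i : ℕ) (a : Bool) :
    vpg i * gl a i = gl a (i + 1) * vpg i * vpg (i + 1) := by
  cases a <;> exact mk_eq_of_rel (mem_VRels_near i _ (by simp [VGen.X, VGen.Y, VGen.P]))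

lemma vpg_mul_self (i : ℕ) : vpg i * vpg i = 1 := by
  rw [← pow_two]
  exact PresentedGroup.one_of_mem (mem_VRels_near i (VGen.P i ^ 2) (by simp))

lemma vpg_inv (i : ℕ) : (vpg i)⁻¹ = vpg i := inv_eq_of_mul_eq_one_left (vpg_mul_self i)

lemma vpg_pow_three (i : ℕ) : (vpg (i + 1) * vpg i) ^ 3 = 1 :=
  PresentedGroup.one_of_mem (mem_VRels_near i ((VGen.P (i + 1) * VGen.P i) ^ 3) (by simp))

lemma vpg_braid (i : ℕ) : vpg (i + 1) * vpg i * vpg (i + 1) = vpg i * vpg (i + 1) * vpg i := by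
  have h := vpg_pow_three i
  have : vpg (i + 1) * vpg i * vpg (i + 1) = (vpg i * vpg (i + 1) * vpg i)⁻¹ := by
    rw [eq_inv_iff_mul_eq_one, ← h]
    simp only [pow_succ, pow_zero, one_mul, mul_assoc]
  rw [this]
  simp only [mul_inv_rev, vpg_inv, mul_assoc]

lemma vpg_mul_gl_of_lt {i j : ℕ} (h : j < i) (a : Bool) :
    vpg i * gl a j = gl a j * vpg (i + 1) := by
  have key : ∀ r ∈ ({VGen.P i * VGen.X j * (VGen.X j * VGen.P (i + 1))⁻¹,
      VGen.P i * VGen.Y j * (VGen.Y j * VGen.P (i + 1))⁻¹} : Set (FreeGroup VGen)),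
      r ∈ VGen.VRels := by
    intro r hr
    simp only [VGen.VRels, Set.mem_union, Set.mem_iUnion]
    exact Or.inl (Or.inl (Or.inr ⟨i, j, h, hr⟩))
  cases a <;> exact mk_eq_of_rel (key _ (by simp [VGen.X, VGen.Y, VGen.P]))

lemma cg_mul_vpg {n k : ℕ} (hk : 1 ≤ k) (hn : k ≤ n) : cg n * vpg k = vpg (k - 1) * cg n := by
  refine mk_eq_of_rel (a := VGen.C n.succPNat * VGen.P k)
    (b := VGen.P (k - 1) * VGen.C n.succPNat) ?_
  simp only [VGen.VRels, Set.mem_union, Set.mem_iUnion]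
  exact Or.inl (Or.inr ⟨n.succPNat, k, hk, hn, rfl⟩)

lemma mem_VRels_cp (n : ℕ) :
    ∀ r ∈ ({VGen.C n.succPNat * VGen.P 0 *
        (((List.range (n + 1)).map VGen.P).prod * VGen.C n.succPNat ^ 2)⁻¹,
      VGen.C n.succPNat ^ 2 * VGen.P 0 *
        (((List.range (n + 1)).reverse.map VGen.P).prod * VGen.C n.succPNat)⁻¹,
      VGen.C n.succPNat ^ 3 * VGen.P 0 * (VGen.P n * VGen.C n.succPNat ^ 3)⁻¹} :
      Set (FreeGroup VGen)), r ∈ VGen.VRels := by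
  intro r hr
  simp only [VGen.VRels, Set.mem_union, Set.mem_iUnion]
  exact Or.inr ⟨n.succPNat, hr⟩

lemma mk_prod_map_P (l : List ℕ) :
    PresentedGroup.mk VGen.VRels (l.map VGen.P).prod = (l.map vpg).prod := by
  rw [map_list_prod, List.map_map]
  rfl

lemma cg_mul_vpg_zero (n : ℕ) :
    cg n * vpg 0 = ((List.range (n + 1)).map vpg).prod * cg n ^ 2 := by
  rw [← mk_prod_map_P]
  exact mk_eq_of_rel (mem_VRels_cp n _ (by simp [VGen.P, VGen.C]))

lemma cg_sq_mul_vpg_zero (n : ℕ) :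
    cg n ^ 2 * vpg 0 = ((List.range (n + 1)).reverse.map vpg).prod * cg n := by
  rw [← mk_prod_map_P]
  exact mk_eq_of_rel (mem_VRels_cp n _ (by simp [VGen.P, VGen.C]))

lemma cg_cube_mul_vpg_zero (n : ℕ) : cg n ^ 3 * vpg 0 = vpg n * cg n ^ 3 :=
  mk_eq_of_rel (mem_VRels_cp n _ (by simp [VGen.P, VGen.C]))

/-! ### Splitting leaves of right vines -/

/-- Attaching a caret of type `a` to the leaf `i` of the right vine with `n + 3` leaves. -/
def ed (n : ℕ) (a : Bool) (i : ℕ) : VhatTau :=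
  if i = n + 2 then cond a (gl true (n + 2))⁻¹ 1 else gl a i

lemma ed_of_lt {n i : ℕ} (h : i < n + 2) (a : Bool) : ed n a i = gl a i := if_neg h.ne

lemma ed_last_false {n i : ℕ} (h : i = n + 2) : ed n false i = 1 := if_pos h

lemma ed_last_true {n i : ℕ} (h : i = n + 2) : ed n true i = (gl true (n + 2))⁻¹ := if_pos h

lemma ed_mul_ed {n i j : ℕ} (hij : i < j) (hj : j ≤ n + 2) (a b : Bool) :
    ed n a j * ed (n + 1) b i = ed n b i * ed (n + 1) a (j + 1) := by
  rw [ed_of_lt (show i < n + 2 by omega), ed_of_lt (show i < n + 1 + 2 by omega)]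
  rcases Nat.lt_or_eq_of_le hj with h | h
  · rw [ed_of_lt h, ed_of_lt (by omega), gl_mul_gl hij]
  · cases a
    · rw [ed_last_false h, ed_last_false (by omega), one_mul, mul_one]
    · rw [ed_last_true h, ed_last_true (by omega), inv_mul_eq_iff_eq_mul, ← mul_assoc,
        gl_mul_gl (show i < n + 2 by omega), mul_inv_cancel_right]

lemma ed_true_sq {n i : ℕ} (hi : i ≤ n + 2) :
    ed n true i * ed (n + 1) true i = ed n false i * ed (n + 1) false (i + 1) := by
  rw [ed_of_lt (show i < n + 1 + 2 by omega)]
  rcases Nat.lt_or_eq_of_le hi with h | h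
  · rw [ed_of_lt h, ed_of_lt h, ed_of_lt (by omega), gl_true_sq]
  · rw [ed_last_true h, ed_last_false h, ed_last_false (by omega), h, inv_mul_cancel, mul_one]

lemma cg_mul_ed_zero (n : ℕ) (a : Bool) :
    cg n * ed n a 0 = ed n a (n + 2) * cg (n + 1) ^ 2 := by
  rw [ed_of_lt (by omega)]
  cases a
  · rw [ed_last_false rfl, one_mul, cg_mul_gl_false_zero]
  · rw [ed_last_true rfl, cg_mul_gl_true_zero]

lemma cg_eq_true (n : ℕ) : cg n = gl true (n + 1) * cg (n + 1) * gl true (n + 2) := by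
  rw [mul_assoc, ← gl_mul_cg (by omega) (by omega), ← mul_assoc, gl_true_sq, mul_assoc, ← cg_eq,
    ← cg_eq]

lemma cg_mul_ed_succ_of_pos {n i : ℕ} (h0 : 0 < i) (hi : i ≤ n + 1) (a : Bool) :
    cg n * ed n a (i + 1) = ed n a i * cg (n + 1) := by
  rw [ed_of_lt (show i < n + 2 by omega)]
  rcases Nat.lt_or_eq_of_le hi with h | rfl
  · rw [ed_of_lt (by omega), gl_mul_cg h0 h]
  · cases a
    · rw [ed_last_false rfl, mul_one, cg_eq]
    · rw [ed_last_true rfl, mul_inv_eq_iff_eq_mul, cg_eq_true]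

lemma cg_pow_mul_ed {n k : ℕ} (hk : k ≤ n + 1) (a : Bool) :
    cg n ^ k * ed n a (n + 2) = ed n a (n + 2 - k) * cg (n + 1) ^ k := by
  induction k with
  | zero => simp
  | succ k ih =>
    rw [pow_succ', mul_assoc, ih (by omega), show n + 2 - k = n + 2 - (k + 1) + 1 by omega,
      ← mul_assoc, cg_mul_ed_succ_of_pos (by omega) (by omega), mul_assoc, pow_succ']

lemma cg_mul_ed_succ {n i : ℕ} (hi : i ≤ n + 1) (a : Bool) :
    cg n * ed n a (i + 1) = ed n a i * cg (n + 1) := by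
  rcases Nat.eq_zero_or_pos i with rfl | h0
  · have h1 : cg n ^ (n + 2) * ed n a 0 = ed n a 1 * cg (n + 1) ^ (n + 3) := by
      rw [pow_succ, mul_assoc, cg_mul_ed_zero, ← mul_assoc, cg_pow_mul_ed le_rfl,
        show n + 2 - (n + 1) = 1 by omega, mul_assoc, ← pow_add]
    have h2 : cg n ^ (n + 2) = (cg n)⁻¹ := eq_inv_of_mul_eq_one_left (by rw [← pow_succ, cg_pow])
    have h3 : cg (n + 1) ^ (n + 3) = (cg (n + 1))⁻¹ :=
      eq_inv_of_mul_eq_one_left (by rw [← pow_succ, cg_pow])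
    rw [h2, h3, inv_mul_eq_iff_eq_mul, ← mul_assoc, eq_mul_inv_iff_mul_eq] at h1
    exact h1.symm
  · exact cg_mul_ed_succ_of_pos h0 hi a

lemma vpg_mul_ed_of_le {n k i : ℕ} (hk : k ≤ n) (h : k + 2 ≤ i) (a : Bool) :
    vpg k * ed n a i = ed n a i * vpg k := by
  unfold ed
  split_ifs with h1
  · cases a
    · simp
    · have := (vpg_mul_gl_of_le (show k + 2 ≤ n + 2 by omega) true)
      simpa using (show Commute _ _ from this).inv_right.eq
  · exact vpg_mul_gl_of_le h a

/-- The group generated by the generators that permute the leaves of the right vine with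
`n + 3` leaves. -/
def S (n : ℕ) : Subgroup VhatTau := Subgroup.closure ({g | ∃ k ≤ n, g = vpg k} ∪ {cg n})

lemma vpg_mem_S {k n : ℕ} (h : k ≤ n) : vpg k ∈ S n :=
  Subgroup.subset_closure (Or.inl ⟨k, h, rfl⟩)

lemma cg_mem_S (n : ℕ) : cg n ∈ S n := Subgroup.subset_closure (Or.inr rfl)

lemma S_induction {n : ℕ} {P : VhatTau → Prop} (one : P 1) (mul : ∀ a b, P a → P b → P (a * b))
    (p : ∀ k ≤ n, P (vpg k)) (c : P (cg n)) {s : VhatTau} (hs : s ∈ S n) : P s := by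
  have hpow : ∀ m, P (cg n ^ m) := fun m => by
    induction m with
    | zero => rwa [pow_zero]
    | succ m ih => rw [pow_succ]; exact mul _ _ ih c
  induction hs using Subgroup.closure_induction'' with
  | one => exact one
  | mem x hx =>
    rcases hx with ⟨k, hk, rfl⟩ | rfl
    · exact p k hk
    · exact c
  | inv_mem x hx =>
    rcases hx with ⟨k, hk, rfl⟩ | rfl
    · rw [vpg_inv]
      exact p k hk
    · rw [← eq_inv_of_mul_eq_one_left (show cg n ^ (n + 2) * cg n = 1 by rw [← pow_succ, cg_pow])]
      exact hpow _
  | mul x y _ _ hx hy => exact mul _ _ hx hy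

lemma exists_mul_ed {n : ℕ} (a : Bool) {s : VhatTau} (hs : s ∈ S n) :
    ∀ i ≤ n + 2, ∃ i' ≤ n + 2, ∃ s' ∈ S (n + 1), s * ed n a i = ed n a i' * s' := by
  refine S_induction (P := fun s => ∀ i ≤ n + 2, ∃ i' ≤ n + 2, ∃ s' ∈ S (n + 1),
    s * ed n a i = ed n a i' * s') ?_ ?_ ?_ ?_ hs
  · exact fun i hi => ⟨i, hi, 1, one_mem _, by simp⟩
  · intro s t hs ht i hi
    obtain ⟨j, hj, t', ht', h1⟩ := ht i hi
    obtain ⟨k, hk, s', hs', h2⟩ := hs j hj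
    exact ⟨k, hk, s' * t', mul_mem hs' ht', by rw [mul_assoc, h1, ← mul_assoc, h2, mul_assoc]⟩
  · intro k hk i hi
    have hp := vpg_mem_S (show k ≤ n + 1 by omega)
    have hp' := vpg_mem_S (show k + 1 ≤ n + 1 by omega)
    have : i < k ∨ i = k ∨ i = k + 1 ∨ k + 2 ≤ i := by omega
    rcases this with h | rfl | rfl | h
    · exact ⟨i, hi, _, hp', by rw [ed_of_lt (by omega), vpg_mul_gl_of_lt h]⟩
    · exact ⟨i + 1, by omega, _, mul_mem hp hp', by
        rw [ed_of_lt (by omega), ed_of_lt (by omega), vpg_mul_gl_self, mul_assoc]⟩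
    · exact ⟨k, by omega, _, mul_mem hp' hp, by
        rw [ed_of_lt (by omega), ed_of_lt (by omega), vpg_mul_gl_succ, mul_assoc]⟩
    · exact ⟨i, hi, _, hp, vpg_mul_ed_of_le hk h a⟩
  · rintro (_ | i) hi
    · exact ⟨n + 2, le_rfl, _, pow_mem (cg_mem_S _) 2, cg_mul_ed_zero n a⟩
    · exact ⟨i, by omega, _, cg_mem_S _, cg_mul_ed_succ (by omega) a⟩

/-! ### Reachability -/

/-- One caret is attached to a leaf of a (marked) right vine with `p.1 + 3` leaves. -/
def Step (p q : ℕ × VhatTau) : Prop := ∃ a, ∃ i ≤ p.1 + 2, q = (p.1 + 1, p.2 * ed p.1 a i)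

/-- The forest expansion relation. -/
def Reach : ℕ × VhatTau → ℕ × VhatTau → Prop := Relation.ReflTransGen Step

lemma Step.mk {n : ℕ} {g : VhatTau} (a : Bool) {i : ℕ} (hi : i ≤ n + 2) :
    Step (n, g) (n + 1, g * ed n a i) := ⟨a, i, hi, rfl⟩

lemma Step.diamond {p q r : ℕ × VhatTau} (h1 : Step p q) (h2 : Step p r) :
    ∃ t, Relation.ReflGen Step q t ∧ Reach r t := by
  obtain ⟨n, g⟩ := p
  obtain ⟨a, i, hi, rfl⟩ := h1
  obtain ⟨b, j, hj, rfl⟩ := h2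
  simp only at hi hj ⊢
  have key : ∀ (a b : Bool) (i j : ℕ), i < j → j ≤ n + 2 →
      Step (n + 1, g * ed n b i) (n + 1 + 1, g * ed n a j * ed (n + 1) b i) := by
    intro a b i j h hj
    rw [mul_assoc, ed_mul_ed h hj, ← mul_assoc]
    exact Step.mk _ (by omega)
  rcases lt_trichotomy i j with h | rfl | h
  · exact ⟨_, .single (key b a i j h hj), .single (Step.mk a (by omega))⟩
  · by_cases hab : a = b
    · subst hab
      exact ⟨_, .refl, .refl⟩
    · have key' : Step (n + 1, g * ed n true i)
          (n + 1 + 1, g * ed n false i * ed (n + 1) false (i + 1)) := by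
        rw [mul_assoc, ← ed_true_sq hi, ← mul_assoc]
        exact Step.mk _ (by omega)
      cases a <;> cases b
      · exact absurd rfl hab
      · exact ⟨_, .single (Step.mk false (by omega)), .single key'⟩
      · exact ⟨_, .single key', .single (Step.mk false (by omega))⟩
      · exact absurd rfl hab
  · exact ⟨_, .single (Step.mk b (by omega)), .single (key a b j i h hi)⟩

lemma Reach.join {p q r : ℕ × VhatTau} (h1 : Reach p q) (h2 : Reach p r) :
    ∃ t, Reach q t ∧ Reach r t := by
  exact Relation.church_rosser (fun _ _ _ h1 h2 => Step.diamond h1 h2) h1 h2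

lemma Reach.mul_left {p q : ℕ × VhatTau} (h : Reach p q) (g : VhatTau) :
    Reach (p.1, g * p.2) (q.1, g * q.2) := by
  refine Relation.ReflTransGen.lift (fun p : ℕ × VhatTau => (p.1, g * p.2)) ?_ _ _ h
  rintro ⟨n, k⟩ _ ⟨a, i, hi, rfl⟩
  exact ⟨a, i, hi, by simp [mul_assoc]⟩

lemma Reach.mul_right {p q : ℕ × VhatTau} (h : Reach p q) {s : VhatTau} (hs : s ∈ S p.1) :
    ∃ s' ∈ S q.1, Reach (p.1, p.2 * s) (q.1, q.2 * s') := by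
  induction h with
  | refl => exact ⟨s, hs, .refl⟩
  | @tail q r _ hqr ih =>
    obtain ⟨s', hs', h⟩ := ih
    obtain ⟨a, i, hi, rfl⟩ := hqr
    obtain ⟨i', hi', t, ht, e⟩ := exists_mul_ed a (inv_mem hs') i hi
    refine ⟨t⁻¹, inv_mem ht, h.tail ⟨a, i', hi', ?_⟩⟩
    rw [inv_mul_eq_iff_eq_mul] at e
    simp only [e, mul_assoc, mul_inv_cancel, mul_one]

lemma gen_induction {P : VhatTau → Prop} (one : P 1) (mul : ∀ a b, P a → P b → P (a * b))
    (inv : ∀ a, P a → P a⁻¹) (gl : ∀ a n, P (gl a n)) (vpg : ∀ n, P (vpg n)) (cg : ∀ n, P (cg n))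
    (g : VhatTau) : P g := by
  have hg : g ∈ Subgroup.closure (Set.range (PresentedGroup.of (rels := VGen.VRels))) := by
    rw [PresentedGroup.closure_range_of]
    trivial
  induction hg using Subgroup.closure_induction with
  | one => exact one
  | mul x y _ _ hx hy => exact mul x y hx hy
  | inv x _ hx => exact inv x hx
  | mem x hx =>
    obtain ⟨z | z | z | z, rfl⟩ := hx
    · exact gl false z
    · exact gl true z
    · exact vpg z
    · obtain ⟨m, rfl⟩ := natPred_spec z
      exact cg m

lemma reach_one (n : ℕ) : Reach (0, 1) (n, 1) := by
  induction n with
  | zero => exact .refl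
  | succ n ih => exact ih.tail ⟨false, n + 2, le_rfl, by rw [ed_last_false rfl, mul_one]⟩

lemma reach_gl (a : Bool) (n : ℕ) : Reach (0, 1) (n + 1, gl a n) :=
  (reach_one n).tail ⟨a, n, by simp, by rw [ed_of_lt (by simp), one_mul]⟩

lemma exists_nf (g : VhatTau) :
    ∃ n s, ∃ σ ∈ S n, Reach (0, 1) (n, s) ∧ Reach (0, 1) (n, g * s * σ) := by
  refine gen_induction (P := fun g => ∃ n s, ∃ σ ∈ S n, Reach (0, 1) (n, s) ∧
    Reach (0, 1) (n, g * s * σ)) ⟨0, 1, 1, one_mem _, .refl, by simpa using reach_one 0⟩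
    ?_ ?_ ?_ ?_ ?_ g
  · rintro g h ⟨n, s, σ, hσ, h1, h2⟩ ⟨m, t, τ, hτ, h3, h4⟩
    obtain ⟨⟨l, u⟩, h5, h6⟩ := h4.join h1
    obtain ⟨σ', hσ', h7⟩ := (h6.mul_left g).mul_right hσ
    obtain ⟨τ', hτ', h8⟩ := (h5.mul_left h⁻¹).mul_right (inv_mem hτ)
    simp only [mul_assoc, inv_mul_cancel_left, mul_inv_cancel, mul_one] at h8
    refine ⟨l, h⁻¹ * u * τ', τ'⁻¹ * σ', mul_mem (inv_mem hτ') hσ', ?_, ?_⟩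
    · have : Reach _ _ := h3.trans h8
      simpa only [mul_assoc] using this
    · have : Reach _ _ := h2.trans h7
      simpa only [mul_assoc, mul_inv_cancel_left] using this
  · rintro g ⟨n, s, σ, hσ, h1, h2⟩
    exact ⟨n, _, _, inv_mem hσ, h2, by simpa [mul_assoc] using h1⟩
  · exact fun a n => ⟨n + 1, 1, 1, one_mem _, reach_one _, by simpa using reach_gl a n⟩
  · exact fun n => ⟨n, 1, _, inv_mem (vpg_mem_S le_rfl), reach_one _, by simpa using reach_one n⟩
  · exact fun n => ⟨n, 1, _, inv_mem (cg_mem_S n), reach_one _, by simpa using reach_one n⟩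

/-! ### Break points -/

/-- The set of the left endpoints of the leaves. -/
def Bp (p : ℕ × VhatTau) : Set (ℕ × Om) := {q | ∃ j ≤ p.1 + 2, rho p.2 (j, zr) = q}

lemma rho_ed_zr {n i j : ℕ} (a : Bool) (hi : i ≤ n + 2) (h : j ≤ i) :
    rho (ed n a i) (j, zr) = (j, zr) := by
  have key : ∀ k, j ≤ k → mg a k (j, zr) = (j, zr) := by
    intro k hk
    rcases Nat.lt_or_eq_of_le hk with hk | hk
    · exact mg_lt hk
    · rw [mg_eq hk, lft_zr, hk]
  rcases Nat.lt_or_eq_of_le hi with h' | h'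
  · rw [ed_of_lt h', rho_gl, key i h]
  · cases a
    · rw [ed_last_false h', map_one, Equiv.Perm.one_apply]
    · rw [ed_last_true h', map_inv, rho_gl, Equiv.Perm.inv_eq_iff_eq, key _ (by omega)]

lemma rho_ed_zr_of_gt {n i j : ℕ} (a : Bool) (h : i + 1 < j) (hj : j ≤ n + 3) :
    rho (ed n a i) (j, zr) = (j - 1, zr) := by
  rw [ed_of_lt (by omega), rho_gl, mg_gt h]

lemma bp_step {n i : ℕ} (g : VhatTau) (a : Bool) (hi : i ≤ n + 2) (q : ℕ × Om) :
    q ∈ Bp (n + 1, g * ed n a i) ↔ q ∈ Bp (n, g) ∨ q = rho (g * ed n a i) (i + 1, zr) := by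
  simp only [Bp, Set.mem_ofPred_eq, map_mul, Equiv.Perm.mul_apply]
  constructor
  · rintro ⟨j, hj, rfl⟩
    have : j ≤ i ∨ j = i + 1 ∨ i + 1 < j := by omega
    rcases this with h | rfl | h
    · exact Or.inl ⟨j, by omega, by rw [rho_ed_zr a hi h]⟩
    · exact Or.inr rfl
    · exact Or.inl ⟨j - 1, by omega, by rw [rho_ed_zr_of_gt a h (by omega)]⟩
  · rintro (⟨j, hj, rfl⟩ | rfl)
    · rcases le_or_gt j i with h | h
      · exact ⟨j, by omega, by rw [rho_ed_zr a hi h]⟩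
      · exact ⟨j + 1, by omega, by rw [rho_ed_zr_of_gt a (by omega) (by omega)]; rfl⟩
    · exact ⟨i + 1, by omega, rfl⟩

lemma Reach.bp_subset {p q : ℕ × VhatTau} (h : Reach p q) : Bp p ⊆ Bp q := by
  induction h with
  | refl => exact subset_rfl
  | @tail q r _ hqr ih =>
    obtain ⟨a, i, hi, rfl⟩ := hqr
    exact fun z hz => (bp_step q.2 a hi z).2 (Or.inl (ih hz))

lemma Reach.le {p q : ℕ × VhatTau} (h : Reach p q) : p.1 ≤ q.1 := by
  induction h with
  | refl => exact le_rfl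
  | tail _ hqr ih =>
    obtain ⟨a, i, hi, rfl⟩ := hqr
    exact ih.trans (Nat.le_succ _)

lemma Reach.eq_or {p q : ℕ × VhatTau} (h : Reach p q) : p = q ∨ p.1 < q.1 := by
  rcases Relation.ReflTransGen.cases_head h with h | ⟨r, h1, h2⟩
  · exact Or.inl h
  · obtain ⟨a, i, hi, rfl⟩ := h1
    exact Or.inr (Nat.lt_of_lt_of_le (Nat.lt_succ_self _) (Reach.le h2))

lemma Reach.of_mem_bp {m : ℕ} {g : VhatTau} {r : ℕ × VhatTau} (h : Reach (m, g) r) (a : Bool)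
    {i : ℕ} (hi : i ≤ m + 2) (hq : rho (g * ed m a i) (i + 1, zr) ∈ Bp r) :
    Reach (m + 1, g * ed m a i) r := by
  have key : ∀ p : ℕ × VhatTau, Reach p r → ∀ (a : Bool) (i : ℕ), i ≤ p.1 + 2 →
      rho (p.2 * ed p.1 a i) (i + 1, zr) ∈ Bp r → Reach (p.1 + 1, p.2 * ed p.1 a i) r := by
    intro p hp
    induction hp using Relation.ReflTransGen.head_induction_on with
    | refl =>
      rintro a i hi ⟨j, hj, h⟩
      rw [map_mul, Equiv.Perm.mul_apply, EmbeddingLike.apply_eq_iff_eq] at h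
      rcases le_or_gt j i with hji | hji
      · rw [← rho_ed_zr a hi hji, EmbeddingLike.apply_eq_iff_eq] at h
        exact absurd (congrArg Prod.fst h) (by simp; omega)
      · rw [show j = j + 1 - 1 by rfl, ← rho_ed_zr_of_gt (n := r.1) a (show i + 1 < j + 1 by omega)
          (by omega), EmbeddingLike.apply_eq_iff_eq] at h
        exact absurd (congrArg Prod.fst h) (by simp; omega)
    | @head p p' hpp' hp' ih =>
      obtain ⟨m, g⟩ := p
      obtain ⟨b, j, hj, rfl⟩ := hpp'
      intro a i hi hq
      simp only at hi hj hq ih ⊢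
      have fin : ∀ (a' b' : Bool) (i' j' : ℕ), i' ≤ m + 3 → j' ≤ m + 3 →
          ed m b j * ed (m + 1) a' i' = ed m a i * ed (m + 1) b' j' →
          rho (ed (m + 1) b' j') (i' + 1, zr) = (i + 1, zr) → Reach (m + 1, g * ed m a i) r := by
        intro a' b' i' j' hi' hj' e e'
        refine Relation.ReflTransGen.head (Step.mk b' hj') ?_
        have := ih a' i' hi'
        rw [mul_assoc, e, ← mul_assoc, map_mul, Equiv.Perm.mul_apply, e'] at this
        exact this hq
      rcases lt_trichotomy i j with h | rfl | h
      · exact fin a b i (j + 1) (by omega) (by omega) (ed_mul_ed h hj _ _)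
          (rho_ed_zr _ (by omega) (by omega))
      · by_cases hab : a = b
        · rw [hab]
          exact hp'
        · cases a <;> cases b
          · exact absurd rfl hab
          · exact fin true false i (i + 1) (by omega) (by omega) (ed_true_sq hi)
              (rho_ed_zr _ (by omega) (by omega))
          · exact fin false true (i + 1) i (by omega) (by omega) (ed_true_sq hi).symm
              (rho_ed_zr_of_gt _ (by omega) (by omega))
          · exact absurd rfl hab
      · exact fin a b (i + 1) j (by omega) (by omega) (ed_mul_ed h hi _ _).symm
          (rho_ed_zr_of_gt _ (by omega) (by omega))
  exact key (m, g) h a i hi hq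

lemma Reach.of_bp_subset {p q r : ℕ × VhatTau} (h1 : Reach p r) (h2 : Reach p q)
    (h : Bp q ⊆ Bp r) : Reach q r := by
  induction h2 with
  | refl => exact h1
  | @tail q q' h2 hq ih =>
    have h3 := ih ((Reach.bp_subset (.single hq)).trans h)
    obtain ⟨a, i, hi, rfl⟩ := hq
    exact h3.of_mem_bp a hi (h ((bp_step q.2 a hi _).2 (Or.inr rfl)))

/-! ### The symmetric groups act faithfully -/

/-- The group generated by `π_0, …, π_{m-1}`. -/
def H (m : ℕ) : Subgroup VhatTau := Subgroup.closure {g | ∃ k < m, g = vpg k}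

lemma vpg_mem_H {k m : ℕ} (h : k < m) : vpg k ∈ H m := Subgroup.subset_closure ⟨k, h, rfl⟩

lemma H_induction {m : ℕ} {P : VhatTau → Prop} (one : P 1) (mul : ∀ a b, P a → P b → P (a * b))
    (p : ∀ k < m, P (vpg k)) {s : VhatTau} (hs : s ∈ H m) : P s := by
  induction hs using Subgroup.closure_induction'' with
  | one => exact one
  | mem x hx =>
    obtain ⟨k, hk, rfl⟩ := hx
    exact p k hk
  | inv_mem x hx =>
    obtain ⟨k, hk, rfl⟩ := hx
    rw [vpg_inv]
    exact p k hk
  | mul x y _ _ hx hy => exact mul _ _ hx hy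

lemma H_fix {m j : ℕ} (hj : m < j) (u : Om) {s : VhatTau} (hs : s ∈ H m) :
    rho s (j, u) = (j, u) := by
  refine H_induction (P := fun s => rho s (j, u) = (j, u)) (by simp) ?_ ?_ hs
  · intro a b ha hb
    rw [map_mul, Equiv.Perm.mul_apply, hb, ha]
  · intro k hk
    rw [rho_vpg, sw_ne (by omega)]

/-- The coset representatives `π_{m-k+1} ⋯ π_m`. -/
def cw (m : ℕ) : ℕ → VhatTau
  | 0 => 1
  | k + 1 => vpg (m - k) * cw m k

lemma rho_cw {m k : ℕ} (hk : k ≤ m + 1) (u : Om) :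
    rho (cw m k) (m + 1, u) = (m + 1 - k, u) := by
  induction k with
  | zero => simp [cw]
  | succ k ih =>
    rw [cw, map_mul, Equiv.Perm.mul_apply, ih (by omega), rho_vpg, sw_right (by omega)]
    congr 1
    omega

lemma vpg_mul_cw_of_lt {m k i : ℕ} (hk : k ≤ m + 1) (hi : i + k < m) :
    vpg i * cw m k = cw m k * vpg i := by
  induction k with
  | zero => simp [cw]
  | succ k ih =>
    rw [cw, ← mul_assoc, vpg_mul_vpg (by omega), mul_assoc, ih (by omega) (by omega), mul_assoc]

lemma vpg_mul_cw_of_gt {m k i : ℕ} (hk : k ≤ m + 1) (hi : i + 1 ≤ m) (h : m < i + k) :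
    vpg (i + 1) * cw m k = cw m k * vpg i := by
  induction k with
  | zero => omega
  | succ k ih =>
    rcases (show m < i + k ∨ m = i + k by omega) with h' | h'
    · rw [cw, ← mul_assoc, ← vpg_mul_vpg (by omega), mul_assoc, ih (by omega) h', mul_assoc]
    · obtain ⟨k, rfl⟩ := Nat.exists_eq_succ_of_ne_zero (show k ≠ 0 by omega)
      rw [cw, cw, show m - (k + 1) = i by omega, show m - k = i + 1 by omega]
      rw [← mul_assoc, ← mul_assoc, vpg_braid, mul_assoc, vpg_mul_cw_of_lt (by omega) (by omega)]
      simp only [mul_assoc]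

lemma exists_cw {m : ℕ} {s : VhatTau} (hs : s ∈ H (m + 1)) :
    ∃ k ≤ m + 1, ∃ t ∈ H m, s = cw m k * t := by
  have key : ∀ k ≤ m + 1, ∃ k' ≤ m + 1, ∃ t ∈ H m, s * cw m k = cw m k' * t := by
    refine H_induction (P := fun s => ∀ k ≤ m + 1, ∃ k' ≤ m + 1, ∃ t ∈ H m,
      s * cw m k = cw m k' * t) (fun k hk => ⟨k, hk, 1, one_mem _, by simp⟩) ?_ ?_ hs
    · intro a b ha hb k hk
      obtain ⟨k', hk', t, ht, h1⟩ := hb k hk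
      obtain ⟨k'', hk'', t', ht', h2⟩ := ha k' hk'
      exact ⟨k'', hk'', t' * t, mul_mem ht' ht, by rw [mul_assoc, h1, ← mul_assoc, h2, mul_assoc]⟩
    · intro i hi k hk
      have : i + k < m ∨ i + k = m ∨ i + k = m + 1 ∨ m + 1 < i + k := by omega
      rcases this with h | h | h | h
      · exact ⟨k, hk, _, vpg_mem_H (by omega), vpg_mul_cw_of_lt hk h⟩
      · refine ⟨k + 1, by omega, 1, one_mem _, ?_⟩
        rw [cw, show m - k = i by omega, mul_one]
      · obtain ⟨k, rfl⟩ := Nat.exists_eq_succ_of_ne_zero (show k ≠ 0 by omega)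
        refine ⟨k, by omega, 1, one_mem _, ?_⟩
        rw [cw, show m - k = i by omega, mul_one, ← mul_assoc, vpg_mul_self, one_mul]
      · obtain ⟨i, rfl⟩ := Nat.exists_eq_succ_of_ne_zero (show i ≠ 0 by omega)
        exact ⟨k, hk, _, vpg_mem_H (by omega), vpg_mul_cw_of_gt hk (by omega) (by omega)⟩
  simpa [cw] using key 0 (by omega)

lemma H_faithful {m : ℕ} {s : VhatTau} (hs : s ∈ H m) (h : ∀ j ≤ m, rho s (j, zr) = (j, zr)) :
    s = 1 := by
  induction m generalizing s with
  | zero => simpa [H] using hs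
  | succ m ih =>
    obtain ⟨k, hk, t, ht, rfl⟩ := exists_cw hs
    have h1 := h (m + 1) le_rfl
    rw [map_mul, Equiv.Perm.mul_apply, H_fix (by omega) _ ht, rho_cw hk] at h1
    have h2 := congrArg Prod.fst h1
    simp only at h2
    obtain rfl : k = 0 := by omega
    simp only [cw, one_mul] at h ⊢
    exact ih ht fun j hj => h j (by omega)

lemma vpg_reverse_prod_mul_cg (n : ℕ) : ((List.range n).reverse.map vpg).prod * cg n =
    cg n * ((List.range n).reverse.map fun k => vpg (k + 1)).prod := by
  have : ∀ l : List ℕ, (∀ k ∈ l, k < n) →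
      (l.map vpg).prod * cg n = cg n * (l.map fun k => vpg (k + 1)).prod := by
    intro l hl
    induction l with
    | nil => simp
    | cons a l ih =>
      simp only [List.forall_mem_cons] at hl
      simp only [List.map_cons, List.prod_cons]
      rw [mul_assoc, ih hl.2, ← mul_assoc, ← mul_assoc, cg_mul_vpg (by omega) hl.1]
      rfl
  exact this _ (by simp)

lemma vpg_succ_prod_mem_H {m : ℕ} (l : List ℕ) (h : ∀ k ∈ l, k < m) :
    (l.map fun k => vpg (k + 1)).prod ∈ H (m + 1) :=
  list_prod_mem (by
    intro x hx
    obtain ⟨k, hk, rfl⟩ := List.mem_map.1 hx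
    exact vpg_mem_H (Nat.succ_lt_succ (h k hk)))

lemma exists_vpg_mul_cg (n : ℕ) : ∃ t ∈ H (n + 1), vpg n * cg n = cg n ^ 2 * t := by
  have hm : ((List.range n).reverse.map fun k => vpg (k + 1)).prod ∈ H (n + 1) :=
    vpg_succ_prod_mem_H _ (by simp)
  have h := cg_sq_mul_vpg_zero n
  rw [List.range_succ, List.reverse_append, List.map_append, List.prod_append] at h
  simp only [List.reverse_cons, List.reverse_nil, List.nil_append, List.map_cons, List.map_nil,
    List.prod_cons, List.prod_nil, mul_one] at h
  rw [mul_assoc (vpg n), vpg_reverse_prod_mul_cg, ← mul_assoc, ← mul_inv_eq_iff_eq_mul] at h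
  exact ⟨_, mul_mem (vpg_mem_H n.succ_pos) (inv_mem hm),
    by rw [← h, mul_assoc]⟩

lemma exists_vpg_mul_cg_sq (n : ℕ) : ∃ t ∈ H (n + 1), vpg n * cg n ^ 2 = cg n * t := by
  have hm : ((List.range n).reverse.map fun k => vpg (k + 1)).prod ∈ H (n + 1) :=
    vpg_succ_prod_mem_H _ (by simp)
  have h := cg_mul_vpg_zero n
  have h' : ∀ m, ((List.range m).map vpg).prod⁻¹ = ((List.range m).reverse.map vpg).prod := by
    intro m
    rw [List.prod_inv_reverse, List.map_reverse, List.map_map]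
    congr 2
    exact List.map_congr_left fun k _ => vpg_inv k
  rw [List.range_succ, List.map_append, List.prod_append] at h
  simp only [List.map_cons, List.map_nil, List.prod_cons, List.prod_nil, mul_one] at h
  rw [mul_assoc, ← inv_mul_eq_iff_eq_mul, h', ← mul_assoc, vpg_reverse_prod_mul_cg] at h
  exact ⟨_, mul_mem hm (vpg_mem_H n.succ_pos),
    by rw [← h, mul_assoc]⟩

lemma exists_vpg_mul_cg_pow {n : ℕ} (k : ℕ) :
    ∀ i ≤ n, ∃ k', ∃ t ∈ H (n + 1), vpg i * cg n ^ k = cg n ^ k' * t := by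
  induction k using Nat.strong_induction_on with
  | _ k ih =>
    intro i hi
    rcases Nat.eq_zero_or_pos k with rfl | hk
    · exact ⟨0, _, vpg_mem_H (Nat.lt_succ_of_le hi), by simp⟩
    rcases Nat.lt_or_eq_of_le hi with hi | rfl
    · obtain ⟨k, rfl⟩ := Nat.exists_eq_succ_of_ne_zero hk.ne'
      obtain ⟨k', t, ht, h⟩ := ih k (Nat.lt_succ_self k) (i + 1) hi
      refine ⟨k' + 1, t, ht, ?_⟩
      have h' := cg_mul_vpg (show 1 ≤ i + 1 by omega) hi
      rw [Nat.add_sub_cancel] at h'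
      rw [pow_succ', ← mul_assoc, ← h', mul_assoc, h, pow_succ', mul_assoc]
    · have : k = 1 ∨ k = 2 ∨ 3 ≤ k := by omega
      rcases this with rfl | rfl | hk
      · obtain ⟨t, ht, h⟩ := exists_vpg_mul_cg i
        exact ⟨2, t, ht, by rw [pow_one, h]⟩
      · obtain ⟨t, ht, h⟩ := exists_vpg_mul_cg_sq i
        exact ⟨1, t, ht, by rw [pow_one, h]⟩
      · obtain ⟨k, rfl⟩ := Nat.exists_eq_add_of_le hk
        obtain ⟨k', t, ht, h⟩ := ih k (by omega) 0 (by omega)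
        refine ⟨3 + k', t, ht, ?_⟩
        rw [pow_add, ← mul_assoc, ← cg_cube_mul_vpg_zero, mul_assoc, h, ← mul_assoc, pow_add]

lemma exists_cg_pow {n : ℕ} {s : VhatTau} (hs : s ∈ S n) :
    ∃ k < n + 3, ∃ t ∈ H (n + 1), s = cg n ^ k * t := by
  have key : ∀ k, ∃ k', ∃ t ∈ H (n + 1), s * cg n ^ k = cg n ^ k' * t := by
    refine S_induction (P := fun s => ∀ k, ∃ k', ∃ t ∈ H (n + 1),
      s * cg n ^ k = cg n ^ k' * t) (fun k => ⟨k, 1, one_mem _, by simp⟩) ?_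
      (fun i hi k => exists_vpg_mul_cg_pow k i hi)
      (fun k => ⟨k + 1, 1, one_mem _, by rw [mul_one, pow_succ']⟩) hs
    intro a b ha hb k
    obtain ⟨k', t, ht, h1⟩ := hb k
    obtain ⟨k'', t', ht', h2⟩ := ha k'
    exact ⟨k'', t' * t, mul_mem ht' ht, by rw [mul_assoc, h1, ← mul_assoc, h2, mul_assoc]⟩
  obtain ⟨k, t, ht, h⟩ := key 0
  refine ⟨k % (n + 3), Nat.mod_lt _ (by omega), t, ht, ?_⟩
  rw [← pow_eq_pow_mod k (cg_pow n)]
  simpa using h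

lemma S_faithful {n : ℕ} {s : VhatTau} (hs : s ∈ S n)
    (h : ∀ j ≤ n + 2, rho s (j, zr) = (j, zr)) : s = 1 := by
  obtain ⟨k, hk, t, ht, rfl⟩ := exists_cg_pow hs
  have h1 := h (n + 2) le_rfl
  rw [map_mul, Equiv.Perm.mul_apply, H_fix (by omega) _ ht, map_pow, rho_cg,
    ← leaf_zr le_rfl, rot_pow_leaf k le_rfl (by omega), leaf_zr le_rfl, leaf_zr (by omega)] at h1
  have h2 := congrArg Prod.fst h1
  simp only at h2
  obtain rfl : k = 0 := by omega
  simp only [pow_zero, one_mul] at h ⊢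
  exact H_faithful ht fun j hj => h j (by omega)

lemma S_leaf {n : ℕ} {s : VhatTau} (hs : s ∈ S n) :
    ∀ j ≤ n + 2, ∃ j' ≤ n + 2, ∀ u, rho s (leaf n j u) = leaf n j' u := by
  refine S_induction (P := fun s => ∀ j ≤ n + 2, ∃ j' ≤ n + 2, ∀ u,
    rho s (leaf n j u) = leaf n j' u) (fun j hj => ⟨j, hj, by simp⟩) ?_ ?_ ?_ hs
  · intro a b ha hb j hj
    obtain ⟨j', hj', h1⟩ := hb j hj
    obtain ⟨j'', hj'', h2⟩ := ha j' hj'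
    exact ⟨j'', hj'', fun u => by rw [map_mul, Equiv.Perm.mul_apply, h1, h2]⟩
  · intro k hk j hj
    simp only [rho_vpg]
    have : j = k ∨ j = k + 1 ∨ (j < k ∨ k + 1 < j) := by omega
    rcases this with h | h | h
    · exact ⟨k + 1, by omega, fun u => sw_leaf_left h hk u⟩
    · exact ⟨k, by omega, fun u => sw_leaf_right h hk u⟩
    · exact ⟨j, hj, fun u => sw_leaf_ne h hk hj u⟩
  · intro j hj
    simp only [rho_cg]
    rcases Nat.eq_zero_or_pos j with h | h
    · exact ⟨n + 2, le_rfl, fun u => rot_leaf_zero h u⟩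
    · exact ⟨j - 1, by omega, fun u => rot_leaf ⟨h, hj⟩ u⟩

lemma eq_one_of_fix {g : VhatTau} (h : ∀ k j, rho (g * k) (j, zr) = rho k (j, zr)) : g = 1 := by
  obtain ⟨n, s, σ, hσ, h1, h2⟩ := exists_nf g
  have hsub : Bp (n, g * s * σ) ⊆ Bp (n, s) := by
    rintro _ ⟨j, hj, rfl⟩
    obtain ⟨j', hj', e⟩ := S_leaf hσ j hj
    have := e zr
    rw [leaf_zr hj, leaf_zr hj'] at this
    exact ⟨j', hj', by
      rw [map_mul, Equiv.Perm.mul_apply, this, h s j']⟩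
  have hs : g * s * σ = s := by
    rcases (h1.of_bp_subset h2 hsub).eq_or with h | h
    · exact congrArg Prod.snd h
    · exact absurd h (lt_irrefl _)
  have hσ1 : σ = 1 := by
    refine S_faithful hσ fun j _ => ?_
    have e : g * (s * σ) = s := by rw [← mul_assoc, hs]
    have := h (s * σ) j
    rw [e, map_mul, Equiv.Perm.mul_apply, EmbeddingLike.apply_eq_iff_eq] at this
    exact this.symm
  rwa [hσ1, mul_one, mul_eq_right] at hs

lemma rho_injective : Function.Injective rho := by
  rw [injective_iff_map_eq_one]
  intro g hg
  exact eq_one_of_fix fun k j => by rw [map_mul, hg, one_mul]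

/-! ### Moving the first transposition -/

lemma cw_fix {m k : ℕ} (hk : k ≤ m) (u : Om) : rho (cw m k) (0, u) = (0, u) := by
  induction k with
  | zero => simp [cw]
  | succ k ih =>
    rw [cw, map_mul, Equiv.Perm.mul_apply, ih (by omega), rho_vpg, sw_ne (by omega)]

lemma exists_rho_eq_zero (j : ℕ) : ∃ t, ∀ u, rho t (j, u) = (0, u) := by
  cases j with
  | zero => exact ⟨1, by simp⟩
  | succ m => exact ⟨cw m (m + 1), fun u => by rw [rho_cw le_rfl, Nat.sub_self]⟩

lemma rho_gl_pow_zero (a : Bool) (k : ℕ) (u : Om) :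
    rho (gl a 0 ^ k) (0, u) = (0, (lft a)^[k] u) := by
  induction k with
  | zero => simp
  | succ k ih =>
    rw [pow_succ', map_mul, Equiv.Perm.mul_apply, ih, rho_gl, mg_eq rfl,
      Function.iterate_succ_apply']

lemma rho_gl_pow_one (a : Bool) (k : ℕ) (u : Om) :
    rho (gl a 1 ^ k) (1, u) = (1, (lft a)^[k] u) := by
  induction k with
  | zero => simp
  | succ k ih =>
    rw [pow_succ', map_mul, Equiv.Perm.mul_apply, ih, rho_gl, mg_eq rfl,
      Function.iterate_succ_apply']

lemma rho_gl_one_pow_fix (a : Bool) (k : ℕ) (u : Om) : rho (gl a 1 ^ k) (0, u) = (0, u) := by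
  induction k with
  | zero => simp
  | succ k ih => rw [pow_succ', map_mul, Equiv.Perm.mul_apply, ih, rho_gl, mg_lt one_pos]

lemma rho_gl_pow_succ (a : Bool) (k : ℕ) (u : Om) : rho (gl a 0 ^ k) (k + 1, u) = (1, u) := by
  induction k with
  | zero => simp
  | succ k ih =>
    rw [pow_succ, map_mul, Equiv.Perm.mul_apply, rho_gl, mg_gt (by omega), ← ih]
    rfl

/-- Leaf `m` of the initial vine is refined only by left carets on its leftmost part. -/
lemma exists_leftmost_leaf {m : ℕ} (hm : m < 2) {p : ℕ × VhatTau} (h : Reach (0, 1) p) :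
    ∃ j < p.1 + 2, ∃ k, ∀ u, rho p.2 (j, u) = (m, lo^[k] u) := by
  induction h with
  | refl => exact ⟨m, by omega, 0, by simp⟩
  | @tail p q _ hq ih =>
    obtain ⟨j, hj, k, ih⟩ := ih
    obtain ⟨a, i, hi, rfl⟩ := hq
    simp only [map_mul, Equiv.Perm.mul_apply]
    rcases lt_trichotomy i j with h | rfl | h
    · refine ⟨j + 1, by omega, k, fun u => ?_⟩
      rw [ed_of_lt (by omega), rho_gl]
      rw [mg_gt (by omega), Nat.add_sub_cancel, ih]
    · cases a
      · refine ⟨i, by omega, k + 2, fun u => ?_⟩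
        rw [ed_of_lt hj, rho_gl, mg_eq rfl, ih]
        rfl
      · refine ⟨i, by omega, k + 1, fun u => ?_⟩
        rw [ed_of_lt hj, rho_gl, mg_eq rfl, ih]
        rfl
    · refine ⟨j, by omega, k, fun u => ?_⟩
      suffices rho (ed p.1 a i) (j, u) = (j, u) by rw [this, ih]
      rcases Nat.lt_or_eq_of_le hi with h' | h'
      · rw [ed_of_lt h', rho_gl, mg_lt h]
      · cases a
        · rw [ed_last_false h', map_one, Equiv.Perm.one_apply]
        · rw [ed_last_true h', map_inv, Equiv.Perm.inv_eq_iff_eq, rho_gl, mg_lt (by omega)]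

/-- Some conjugate of `g` conjugates `π_0` to a transposition with disjoint support. -/
def Moves (g : VhatTau) : Prop :=
  ∃ κ j, 2 ≤ j ∧ κ * g * κ⁻¹ * vpg 0 = vpg j * (κ * g * κ⁻¹)

lemma Moves.of_conj {g : VhatTau} (w : VhatTau) (h : Moves (w * g * w⁻¹)) : Moves g := by
  obtain ⟨κ, j, hj, h⟩ := h
  have e : κ * (w * g * w⁻¹) * κ⁻¹ = κ * w * g * (κ * w)⁻¹ := by group
  exact ⟨κ * w, j, hj, by rw [← e, h]⟩

lemma Moves.of_inv_conj {g : VhatTau} (w : VhatTau) (h : Moves (w⁻¹ * g * w)) : Moves g :=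
  .of_conj w⁻¹ (by rwa [inv_inv])

lemma moves_of_halves {g : VhatTau} {j : ℕ} (hj : 2 ≤ j) (h0 : ∀ u, rho g (0, u) = (j, u))
    (h1 : ∀ u, rho g (1, u) = (j + 1, u)) : Moves g := by
  refine ⟨1, j, hj, ?_⟩
  rw [one_mul, inv_one, mul_one]
  apply rho_injective
  ext1 ⟨k, u⟩
  simp only [map_mul, Equiv.Perm.mul_apply, rho_vpg]
  have : k = 0 ∨ k = 1 ∨ 1 < k := by omega
  rcases this with rfl | rfl | hk
  · rw [sw_left rfl, h0, sw_left rfl, zero_add, h1]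
  · rw [sw_right rfl, h0, h1, sw_right rfl]
  · rw [sw_ne (by omega)]
    obtain ⟨⟨l, w⟩, hq⟩ : ∃ q, rho g (k, u) = q := ⟨_, rfl⟩
    rw [hq]
    have hl : l ≠ j := by
      rintro rfl
      rw [← h0, EmbeddingLike.apply_eq_iff_eq] at hq
      have := congrArg Prod.fst hq
      simp only at this
      omega
    have hl' : l ≠ j + 1 := by
      rintro rfl
      rw [← h1, EmbeddingLike.apply_eq_iff_eq] at hq
      have := congrArg Prod.fst hq
      simp only at this
      omega
    rw [sw_ne (by omega)]

lemma moves_of_leaf {g : VhatTau} {k : ℕ} (h : ∀ u, rho g (0, u) = (k + 1, u)) : Moves g := by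
  refine .of_inv_conj (gl false (k + 1) * gl false 0) (moves_of_halves (j := k + 2) (by omega)
    (fun u => ?_) fun u => ?_)
  · rw [map_mul, map_mul, map_inv, Equiv.Perm.mul_apply, Equiv.Perm.mul_apply,
      Equiv.Perm.inv_eq_iff_eq]
    simp only [map_mul, Equiv.Perm.mul_apply, rho_gl]
    rw [mg_eq rfl, mg_lt (by omega), h, mg_gt (k := k + 2) (by omega), mg_eq (by omega)]
  · rw [map_mul, map_mul, map_inv, Equiv.Perm.mul_apply, Equiv.Perm.mul_apply,
      Equiv.Perm.inv_eq_iff_eq]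
    simp only [map_mul, Equiv.Perm.mul_apply, rho_gl]
    rw [mg_succ rfl, mg_lt (by omega), h, mg_gt (k := k + 2 + 1) (by omega),
      mg_succ (by omega)]

lemma moves_of_lo_pow {g : VhatTau} {k l : ℕ}
    (h : ∀ u, rho g (0, lo^[k] u) = (1, lo^[l] u)) : Moves g := by
  refine .of_inv_conj (gl true 1 ^ l * gl true 0 ^ k) (moves_of_leaf (k := k) fun u => ?_)
  rw [map_mul, map_mul, map_inv, Equiv.Perm.mul_apply, Equiv.Perm.mul_apply,
    Equiv.Perm.inv_eq_iff_eq, map_mul, Equiv.Perm.mul_apply, Equiv.Perm.mul_apply,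
    rho_gl_pow_zero, rho_gl_one_pow_fix, rho_gl_pow_succ, rho_gl_pow_one]
  exact h u

lemma moves_of_zr_one {g : VhatTau} (h : rho g (0, zr) = (1, zr)) : Moves g := by
  obtain ⟨n, s, σ, hσ, h1, h2⟩ := exists_nf g
  obtain ⟨i, hi, k, hk⟩ := exists_leftmost_leaf zero_lt_two h1
  obtain ⟨j, hj, l, hl⟩ := exists_leftmost_leaf one_lt_two h2
  simp only at hi hk hj hl
  obtain ⟨j', hj', e⟩ := S_leaf (inv_mem hσ) i hi.le
  have lo_pow_zr : ∀ k, lo^[k] zr = zr := fun k => by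
    induction k with
    | zero => rfl
    | succ k ih => rw [Function.iterate_succ_apply, lo_zr, ih]
  have e' : ∀ u, rho (g * s * σ) (leaf n j' u) = rho g (0, lo^[k] u) := fun u => by
    rw [← e, leaf_of_lt hi, map_inv, map_mul, map_mul, Equiv.Perm.mul_apply,
      Equiv.Perm.mul_apply, Equiv.Perm.coe_inv, Equiv.apply_symm_apply, hk]
  obtain rfl : j' = j := by
    have := e' zr
    rw [lo_pow_zr, h, leaf_zr hj', ← lo_pow_zr l, ← hl, EmbeddingLike.apply_eq_iff_eq] at this
    exact congrArg Prod.fst this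
  exact moves_of_lo_pow fun u => by rw [← e', leaf_of_lt hj, hl]

lemma moves_of_zr_succ {g : VhatTau} {j : ℕ} (h : rho g (0, zr) = (j + 1, zr)) : Moves g := by
  refine .of_conj (cw j j) (moves_of_zr_one ?_)
  have : (rho (cw j j))⁻¹ (0, zr) = (0, zr) := by rw [Equiv.Perm.inv_eq_iff_eq, cw_fix le_rfl]
  rw [map_mul, map_mul, map_inv, Equiv.Perm.mul_apply, Equiv.Perm.mul_apply, this, h,
    rho_cw (by omega), Nat.add_sub_cancel_left]

lemma reach_fix_zr {p : ℕ × VhatTau} (h : Reach (0, 1) p) : rho p.2 (0, zr) = (0, zr) := by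
  induction h with
  | refl => simp
  | @tail p q _ hq ih =>
    obtain ⟨a, i, hi, rfl⟩ := hq
    rw [map_mul, Equiv.Perm.mul_apply, rho_ed_zr a hi (Nat.zero_le _), ih]

lemma moves_of_zr_ne {g : VhatTau} (h : rho g (0, zr) ≠ (0, zr)) : Moves g := by
  obtain ⟨n, s, σ, hσ, h1, h2⟩ := exists_nf g
  obtain ⟨j, hj, e⟩ := S_leaf (inv_mem hσ) 0 (Nat.zero_le _)
  have e' : rho (g * s * σ) (j, zr) = rho g (0, zr) := by
    have := e zr
    rw [leaf_zr (Nat.zero_le _), leaf_zr hj] at this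
    rw [← this, map_inv, map_mul, map_mul, Equiv.Perm.mul_apply, Equiv.Perm.mul_apply,
      Equiv.Perm.coe_inv, Equiv.apply_symm_apply, reach_fix_zr h1]
  have hs := reach_fix_zr h2
  simp only at hs
  cases j with
  | zero => exact absurd (e'.symm.trans hs) h
  | succ j =>
    refine .of_inv_conj (g * s * σ) (moves_of_zr_succ (j := j) ?_)
    rw [map_mul, map_mul, map_inv, Equiv.Perm.mul_apply, Equiv.Perm.mul_apply, hs,
      Equiv.Perm.inv_eq_iff_eq, e']

lemma moves_of_ne_one {g : VhatTau} (h : g ≠ 1) : Moves g := by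
  by_contra hg
  refine h (eq_one_of_fix fun k j => ?_)
  by_contra hkj
  obtain ⟨t, ht⟩ := exists_rho_eq_zero j
  refine hg (.of_inv_conj k (.of_conj t (moves_of_zr_ne fun hfix => hkj ?_)))
  have : (rho t)⁻¹ (0, zr) = (j, zr) := by rw [Equiv.Perm.inv_eq_iff_eq, ht]
  simp only [map_mul, map_inv, Equiv.Perm.mul_apply] at hfix
  rw [this, ← ht zr, EmbeddingLike.apply_eq_iff_eq, Equiv.Perm.inv_eq_iff_eq] at hfix
  rw [map_mul, Equiv.Perm.mul_apply, hfix]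

/-! ### The normal closure of the first transposition -/

lemma vpg_zero_eq_conj : gl false 0 * gl false 2 * (vpg 1 * (vpg 0 * vpg 2) * vpg 1) =
    vpg 0 * (gl false 0 * gl false 2) := by
  have h1 := vpg_mul_gl_self 0 false
  have h2 := vpg_mul_gl_succ 0 false
  have h3 := vpg_mul_gl_succ 1 false
  have h4 := gl_mul_gl zero_lt_one false false
  simp only [zero_add, one_add_one_eq_two] at h1 h2 h3 h4
  rw [← mul_assoc (vpg 0), h1, mul_assoc _ (vpg 1), h3, mul_assoc (gl false 1) (vpg 0),
    ← mul_assoc (vpg 0), ← mul_assoc (vpg 0), h2, ← h4]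
  simp only [mul_assoc]

lemma vpg_conj (n : ℕ) : vpg (n + 1) * vpg n * vpg (n + 1) * (vpg (n + 1) * vpg n)⁻¹ = vpg n := by
  rw [vpg_braid, mul_inv_eq_iff_eq_mul, mul_assoc]

lemma exists_mem_ker_conj_eq {φ : VhatTau →* Multiplicative (ZMod 2)}
    (hy : ∀ n, φ (gl true n) = Multiplicative.ofAdd 1) {w : VhatTau} {m : ℕ}
    (hw : w * gl true m = gl true m * w) (κ : VhatTau) :
    ∃ κ' ∈ φ.ker, κ' * w * κ'⁻¹ = κ * w * κ⁻¹ := by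
  have h : ∀ z : Multiplicative (ZMod 2), z = 1 ∨ z * Multiplicative.ofAdd 1 = 1 := by decide
  rcases h (φ κ) with h | h
  · exact ⟨κ, h, rfl⟩
  · refine ⟨κ * gl true m, by rw [MonoidHom.mem_ker, map_mul, hy, h], ?_⟩
    rw [mul_inv_rev, mul_assoc κ, ← hw]
    group

/-- Every nontrivial subgroup of the kernel that is normalized by the kernel contains `π_0`. -/
lemma vpg_zero_mem {φ : VhatTau →* Multiplicative (ZMod 2)}
    (hx : ∀ n, φ (gl false n) = 1) (hp : ∀ n, φ (vpg n) = 1)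
    (hy : ∀ n, φ (gl true n) = Multiplicative.ofAdd 1) {N : Subgroup VhatTau}
    (hN : ∀ κ ∈ φ.ker, ∀ g ∈ N, κ * g * κ⁻¹ ∈ N) {f : VhatTau} (hf : f ∈ N) (hf1 : f ≠ 1) :
    vpg 0 ∈ N := by
  obtain ⟨κ, j, hj, h⟩ := moves_of_ne_one hf1
  obtain ⟨i, rfl⟩ := Nat.exists_eq_add_of_le' hj
  have hi : vpg (i + 2) * vpg 0 ∈ N := by
    have h1 : κ⁻¹ * vpg 0 * κ ∈ φ.ker := by
      rw [MonoidHom.mem_ker, map_mul, map_mul, hp, mul_one, ← map_mul, inv_mul_cancel, map_one]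
    have h2 : κ⁻¹ * (vpg (i + 2) * vpg 0) * κ ∈ N := by
      have h3 : κ⁻¹ * (vpg (i + 2) * vpg 0) * κ =
          f * ((κ⁻¹ * vpg 0 * κ) * f⁻¹ * (κ⁻¹ * vpg 0 * κ)⁻¹) := by
        rw [← mul_inv_eq_iff_eq_mul] at h
        rw [← h]
        simp only [mul_inv_rev, inv_inv, mul_assoc, vpg_inv, inv_mul_cancel_left]
      rw [h3]
      exact mul_mem hf (hN _ h1 _ (inv_mem hf))
    obtain ⟨κ', hκ', e⟩ := exists_mem_ker_conj_eq (m := i + 4) hy (w := vpg (i + 2) * vpg 0) (by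
      rw [mul_assoc, vpg_mul_gl_of_le (by omega), ← mul_assoc, vpg_mul_gl_of_le (by omega),
        mul_assoc]) κ⁻¹
    rw [inv_inv] at e
    rw [← e] at h2
    simpa [mul_assoc] using hN _ (inv_mem hκ') _ h2
  have h2 : vpg 0 * vpg 2 ∈ N := by
    clear h hj
    induction i with
    | zero => rwa [vpg_mul_vpg le_rfl]
    | succ i ih =>
      refine ih ?_
      have h5 : Commute (vpg (i + 2 + 1) * vpg (i + 2)) (vpg 0) :=
        .mul_left (vpg_mul_vpg (by omega)).symm (vpg_mul_vpg (by omega)).symm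
      rw [← vpg_conj, mul_assoc, h5.inv_left.eq, ← mul_assoc, mul_assoc _ _ (vpg 0)]
      exact hN _ (by rw [MonoidHom.mem_ker, map_mul, hp, hp, mul_one]) _ hi
  have h3 := hN (gl false 0 * gl false 2 * vpg 1)
    (by rw [MonoidHom.mem_ker, map_mul, map_mul, hx, hx, hp]; rfl) _ h2
  have h4 := vpg_zero_eq_conj
  rw [← mul_inv_eq_iff_eq_mul] at h4
  rw [← h4]
  simpa only [mul_inv_rev, vpg_inv, mul_assoc] using h3

lemma ker_le_of_vpg_zero_mem {φ : VhatTau →* Multiplicative (ZMod 2)}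
    (hx : ∀ n, φ (gl false n) = 1) (hp : ∀ n, φ (vpg n) = 1) (hc : ∀ n, φ (cg n) = 1)
    (hy : ∀ n, φ (gl true n) = Multiplicative.ofAdd 1) {N : Subgroup VhatTau} [hN : N.Normal]
    (h : vpg 0 ∈ N) : φ.ker ≤ N := by
  have hpN : ∀ n, vpg n ∈ N := fun n => by
    induction n with
    | zero => exact h
    | succ n ih =>
      rw [← vpg_conj] at ih
      simpa [mul_assoc] using hN.conj_mem _ ih (vpg (n + 1) * vpg n)⁻¹
  set q := QuotientGroup.mk' N with hq
  have q1 : ∀ {g}, q g = 1 ↔ g ∈ N := by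
    intro g
    rw [← MonoidHom.mem_ker, QuotientGroup.ker_mk']
  have qp : ∀ n, q (vpg n) = 1 := fun n => q1.2 (hpN n)
  have qc : ∀ n, q (cg n) = 1 := fun n => by
    have := congrArg q (cg_mul_vpg_zero n)
    have h' : ((List.range (n + 1)).map vpg).prod ∈ N :=
      list_prod_mem (by simpa using fun k _ => hpN k)
    rw [map_mul, map_mul, qp, q1.2 h', map_pow, mul_one, one_mul, pow_two] at this
    simpa using this
  have qx : ∀ n, q (gl false n) = 1 := fun n => by
    cases n with
    | zero => simpa [qc] using congrArg q (cg_mul_gl_false_zero 0)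
    | succ n => simpa [qc] using (congrArg q (cg_eq n)).symm
  have qsq : ∀ n, q (gl true n) * q (gl true n) = 1 := fun n => by
    simpa [qx] using congrArg q (gl_true_sq n)
  have q0 : ∀ n, q (gl true n) = q (gl true 0) := by
    have q2 : ∀ n, q (gl true (n + 2)) = q (gl true 0) := fun n => by
      have := congrArg q (cg_mul_gl_true_zero n)
      rw [map_mul, map_mul, map_pow, map_inv, qc, qc, one_mul, one_pow, mul_one] at this
      rw [this, eq_inv_iff_mul_eq_one, qsq]
    intro n
    match n with
    | 0 => rfl
    | 1 =>
      have := congrArg q (gl_mul_gl zero_lt_one true true)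
      rw [map_mul, map_mul, q2 0, mul_left_inj] at this
      exact this
    | n + 2 => exact q2 n
  have key : ∀ g, φ g = 1 ∧ q g = 1 ∨ φ g = Multiplicative.ofAdd 1 ∧ q g = q (gl true 0) := by
    have e : (Multiplicative.ofAdd 1 : Multiplicative (ZMod 2)) * Multiplicative.ofAdd 1 = 1 := rfl
    refine gen_induction (Or.inl ⟨map_one _, map_one _⟩) ?_ ?_ ?_ (fun n => Or.inl ⟨hp n, qp n⟩)
      (fun n => Or.inl ⟨hc n, qc n⟩)
    · rintro a b (⟨h1, h2⟩ | ⟨h1, h2⟩) (⟨h3, h4⟩ | ⟨h3, h4⟩) <;>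
        simp [map_mul, h1, h2, h3, h4, qsq, e]
    · rintro a (⟨h1, h2⟩ | ⟨h1, h2⟩)
      · simp [map_inv, h1, h2]
      · refine Or.inr ⟨?_, ?_⟩
        · rw [map_inv, h1, inv_eq_iff_mul_eq_one, e]
        · rw [map_inv, h2, inv_eq_iff_mul_eq_one, qsq]
    · rintro (_ | _) n
      · exact Or.inl ⟨hx n, qx n⟩
      · exact Or.inr ⟨hy n, q0 n⟩
  intro g hg
  rcases key g with h | h
  · exact q1.1 h.2
  · rw [MonoidHom.mem_ker, h.1] at hg
    exact absurd hg (by decide)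

lemma ker_le {φ : VhatTau →* Multiplicative (ZMod 2)}
    (hx : ∀ n, φ (gl false n) = 1) (hp : ∀ n, φ (vpg n) = 1) (hc : ∀ n, φ (cg n) = 1)
    (hy : ∀ n, φ (gl true n) = Multiplicative.ofAdd 1) {N : Subgroup VhatTau}
    (hN : ∀ κ ∈ φ.ker, ∀ g ∈ N, κ * g * κ⁻¹ ∈ N) {f : VhatTau} (hf : f ∈ N) (hf1 : f ≠ 1) :
    φ.ker ≤ N := by
  refine (ker_le_of_vpg_zero_mem hx hp hc hy (N := Subgroup.normalClosure {vpg 0})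
    (Subgroup.subset_normalClosure rfl)).trans ?_
  rw [Subgroup.normalClosure, Subgroup.closure_le]
  intro g hg
  obtain ⟨_, rfl, hc⟩ := Group.mem_conjugatesOfSet_iff.1 hg
  obtain ⟨κ, rfl⟩ := isConj_iff.1 hc
  obtain ⟨κ', hκ', e⟩ := exists_mem_ker_conj_eq hy (vpg_mul_gl_of_le (show 0 + 2 ≤ 2 by rfl) true) κ
  rw [← e]
  exact hN _ hκ' _ (vpg_zero_mem hx hp hy hN hf hf1)

lemma vpg_zero_ne_one : vpg 0 ≠ 1 := by
  intro h
  have := congrArg (fun g => (rho g (0, zr)).1) h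
  simp [rho_vpg, sw_left] at this

lemma isSimpleGroup_ker {φ : VhatTau →* Multiplicative (ZMod 2)}
    (hx : ∀ n, φ (gl false n) = 1) (hp : ∀ n, φ (vpg n) = 1) (hc : ∀ n, φ (cg n) = 1)
    (hy : ∀ n, φ (gl true n) = Multiplicative.ofAdd 1) : IsSimpleGroup φ.ker where
  exists_pair_ne := ⟨⟨vpg 0, hp 0⟩, 1, fun h => vpg_zero_ne_one (congrArg Subtype.val h)⟩
  eq_bot_or_eq_top_of_normal N hN := by
    rw [or_iff_not_imp_left]
    intro hb
    obtain ⟨⟨f, hf⟩, hf1⟩ := Subgroup.ne_bot_iff_exists_ne_one.1 hb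
    refine Subgroup.eq_top_iff' N |>.2 fun κ => ?_
    have hle := ker_le hx hp hc hy (N := N.map φ.ker.subtype) ?_
      (Subgroup.mem_map_of_mem _ hf) fun h => hf1 (Subtype.ext (Subtype.ext h))
    · obtain ⟨κ', hκ', e⟩ := hle κ.2
      rwa [← Subtype.ext e]
    · rintro κ hκ _ ⟨g, hg, rfl⟩
      exact ⟨_, hN.conj_mem g hg ⟨κ, hκ⟩, rfl⟩

end VTau

/-- The group `V_xz`, the kernel of the parity-of-`y` homomorphism, is simple. -/
theorem Vxz_simple (φ : VhatTau →* Multiplicative (ZMod 2))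
    (hx : ∀ n : ℕ, φ (vxg n) = Multiplicative.ofAdd (0 : ZMod 2))
    (hp : ∀ n : ℕ, φ (vpg n) = Multiplicative.ofAdd (0 : ZMod 2))
    (hc : ∀ n : ℕ+, φ (vcg n) = Multiplicative.ofAdd (0 : ZMod 2))
    (hy : ∀ n : ℕ, φ (vyg n) = Multiplicative.ofAdd (1 : ZMod 2)) :
    IsSimpleGroup (MonoidHom.ker φ) := by
  have hc' : ∀ n, φ (VTau.cg n) = 1 := fun n => hc n.succPNat
  exact VTau.isSimpleGroup_ker hx hp hc' hy

end
end
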